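/- arXiv:1405.1687 — 3 statements merged into one kernel-verified Lean document; each statement's English description precedes it below -/
import Mathlib

section
/- Let T be a finite simplicial complex that is a triangulated ball whose dual graph (one node for each maximal simplex, with two nodes adjacent precisely when the corresponding maximal simplices share a common facet) is a tree. Then T is flag, i.e. every minimal non-face of T has exactly two elements. -/
/-- `x` is a point of the standard lattice `ℤ^d ⊆ ℝ^d`. -/
def Zd {d : ℕ} (x : Fin d → ℝ) : Prop := ∀ i, ∃ z : ℤ, x i = (z : ℝ)

/-- `x` lies in the affine lattice generated (over `ℤ`) by the finite point set `F`. -/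
def InAffLat {E : Type*} [AddCommGroup E] [Module ℝ E] (F : Finset E) (x : E) : Prop :=
  ∃ c : E → ℤ, (∀ a, a ∉ F → c a = 0) ∧ (∑ a ∈ F, c a) = 1 ∧ (∑ a ∈ F, (c a : ℝ) • a) = x

/-- `F` is the vertex set of a unimodular simplex with respect to the lattice predicate `L`:
its vertices are affinely independent lattice points which affinely generate every lattice
point of their affine span. -/
def UnimodularFinset {E : Type*} [AddCommGroup E] [Module ℝ E] (L : E → Prop)
    (F : Finset E) : Prop :=
  (∀ a ∈ F, L a) ∧ AffineIndependent ℝ (fun p : F => (p : E)) ∧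
    ∀ x, L x → x ∈ affineSpan ℝ (F : Set E) → InAffLat F x

/-- A (geometric) triangulation of the set `P`, recorded by the vertex sets of its faces:
faces are affinely independent, the collection is closed under taking subsets, convex hulls
of faces intersect in the convex hull of the common vertices, and the faces cover `P`. -/
def IsTriangulation {E : Type*} [AddCommGroup E] [Module ℝ E]
    (P : Set E) (T : Finset (Finset E)) : Prop :=
  (∀ F ∈ T, AffineIndependent ℝ (fun p : F => (p : E))) ∧
  (∀ F ∈ T, ∀ G, G ⊆ F → G ∈ T) ∧
  (∀ F ∈ T, ∀ G ∈ T,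
    convexHull ℝ (F : Set E) ∩ convexHull ℝ (G : Set E) =
      convexHull ℝ ((F : Set E) ∩ (G : Set E))) ∧
  (⋃ F ∈ T, convexHull ℝ (F : Set E)) = P

/-- `F` is a maximal cell of the triangulation `T`. -/
def MaxCell {E : Type*} (T : Finset (Finset E)) (F : Finset E) : Prop :=
  F ∈ T ∧ ∀ G ∈ T, F ⊆ G → G = F

/-- A triangulation is unimodular when all of its maximal cells are unimodular simplices. -/
def IsUnimodular {E : Type*} [AddCommGroup E] [Module ℝ E] (L : E → Prop)
    (T : Finset (Finset E)) : Prop :=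
  ∀ F, MaxCell T F → UnimodularFinset L F

/-- A triangulation is regular when its maximal cells are the domains of linearity of a
piecewise linear convex function on `P`. -/
def IsRegularTri {E : Type*} [AddCommGroup E] [Module ℝ E]
    (P : Set E) (T : Finset (Finset E)) : Prop :=
  ∃ f : E → ℝ, ConvexOn ℝ P f ∧
    (∀ F, MaxCell T F → ∃ g : E →ᵃ[ℝ] ℝ, Set.EqOn f (⇑g) (convexHull ℝ (F : Set E))) ∧
    (∀ F G, MaxCell T F → MaxCell T G → F ≠ G →
      ¬ ∃ g : E →ᵃ[ℝ] ℝ,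
        Set.EqOn f (⇑g) (convexHull ℝ (F : Set E) ∪ convexHull ℝ (G : Set E)))

/-- `N` is a minimal non-face of the triangulation `T`: a set of vertices of `T` which is
not a face, all of whose proper subsets are faces. -/
def MinNonFace {E : Type*} (T : Finset (Finset E)) (N : Finset E) : Prop :=
  (∀ x ∈ N, ({x} : Finset E) ∈ T) ∧ N ∉ T ∧ ∀ M, M ⊂ N → M ∈ T

/-- A triangulation is flag when all of its minimal non-faces have exactly two elements. -/
def IsFlag {E : Type*} (T : Finset (Finset E)) : Prop :=
  ∀ N, MinNonFace T N → N.card = 2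

/-- A triangulation of `P` is full when every lattice point of `P` is one of its vertices. -/
def IsFull {E : Type*} (L : E → Prop) (P : Set E) (T : Finset (Finset E)) : Prop :=
  ∀ x ∈ P, L x → ({x} : Finset E) ∈ T

/-- `P` is a lattice polytope with respect to the lattice predicate `L`. -/
def IsLatticePolytope {E : Type*} [AddCommGroup E] [Module ℝ E] (L : E → Prop)
    (P : Set E) : Prop :=
  ∃ V : Finset E, V.Nonempty ∧ (∀ v ∈ V, L v) ∧ P = convexHull ℝ (V : Set E)

open MeasureTheory Metric Set Filter Topology in
/-- The determinant of a pencil `t ↦ 1 + t • A` is determined at `t = 1` by its values at finitely many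
other points, by a formula which does not depend on `A`. -/
theorem exists_det_one_add_eq_sum {E : Type*} [NormedAddCommGroup E] [NormedSpace ℝ E]
    [FiniteDimensional ℝ E] {ε : ℝ} (hε : 0 < ε) :
    ∃ (s : Finset ℕ) (v w : ℕ → ℝ), (∀ i, 0 < v i ∧ v i < ε) ∧
      ∀ A : E →L[ℝ] E, (1 + A).det = ∑ i ∈ s, (1 + v i • A).det * w i := by
  classical
  let b := Module.finBasis ℝ E
  let d := Module.finrank ℝ E
  let v : ℕ → ℝ := fun i => ε / (i + 2)
  have hv : Function.Injective v := by
    intro i j h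
    have h1 : ((i : ℝ) + 2) ≠ 0 := by positivity
    have h2 : ((j : ℝ) + 2) ≠ 0 := by positivity
    simp only [v] at h
    field_simp at h
    exact_mod_cast (by linarith : (i : ℝ) = j)
  refine ⟨Finset.range (d + 1), v,
    fun i => (Lagrange.basis (Finset.range (d + 1)) v i).eval 1, fun i => ⟨by positivity, ?_⟩, ?_⟩
  · simp only [v]
    rw [div_lt_iff₀ (by positivity)]
    have : (0 : ℝ) ≤ i := by positivity
    nlinarith
  intro A
  let M := LinearMap.toMatrix b b (A : E →ₗ[ℝ] E)
  let p : Polynomial ℝ := Matrix.det ((Polynomial.X : Polynomial ℝ) • M.map Polynomial.C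
    + (1 : Matrix _ _ ℝ).map Polynomial.C)
  have hp : ∀ t : ℝ, p.eval t = (1 + t • A).det := by
    intro t
    have h1 : (1 + t • A).det = LinearMap.det ((1 : E →ₗ[ℝ] E) + t • (A : E →ₗ[ℝ] E)) := rfl
    rw [h1, ← LinearMap.det_toMatrix b]
    simp only [p]
    rw [← Polynomial.coe_evalRingHom, RingHom.map_det]
    congr 1
    ext i j
    simp [M, Matrix.one_apply, add_comm, LinearMap.toMatrix_one, apply_ite (Polynomial.eval t)]
    exact mul_comm _ _
  have hdeg : p.degree < (Finset.range (d + 1)).card := by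
    rw [Finset.card_range]
    refine lt_of_le_of_lt Polynomial.degree_le_natDegree ?_
    have := Polynomial.natDegree_det_X_add_C_le M 1
    rw [Fintype.card_fin] at this
    exact_mod_cast Nat.lt_succ_of_le this
  have key := Lagrange.eq_interpolate (hv.injOn) hdeg
  have h1 : (1 + A).det = p.eval 1 := by rw [hp, one_smul]
  rw [h1, key, Lagrange.interpolate_apply, Polynomial.eval_finsetSum]
  exact Finset.sum_congr rfl fun i _ => by rw [Polynomial.eval_mul, Polynomial.eval_C, hp]

open MeasureTheory Metric Set Filter Topology in
/-- A Lipschitz map on the closed unit ball vanishing on the sphere extends by zero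
to a Lipschitz map. -/
theorem LipschitzOnWith.extend_zero {E : Type*} [NormedAddCommGroup E] [NormedSpace ℝ E]
    {f u : E → E} {L : NNReal} (hf : LipschitzOnWith L f (closedBall 0 1))
    (h0 : ∀ x, ‖x‖ = 1 → f x = 0) (hin : ∀ x, ‖x‖ ≤ 1 → u x = f x)
    (hout : ∀ x, 1 < ‖x‖ → u x = 0) : LipschitzWith L u := by
  have cross : ∀ x y : E, ‖x‖ ≤ 1 → 1 < ‖y‖ → dist (u x) (u y) ≤ L * dist x y := by
    intro x y hx hy
    obtain ⟨z, hz, hz1⟩ : ∃ z ∈ segment ℝ x y, ‖z‖ = 1 := by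
      have := (convex_segment x y).isPreconnected.intermediate_value
        (left_mem_segment ℝ x y) (right_mem_segment ℝ x y) continuous_norm.continuousOn
      exact this ⟨hx, hy.le⟩
    have h1 := hf.dist_le_mul x (by simpa using hx) z (by simp [hz1])
    have h2 := dist_add_dist_of_mem_segment hz
    rw [hin x hx, hout y hy, ← h0 z hz1]
    refine h1.trans (mul_le_mul_of_nonneg_left ?_ L.2)
    linarith [dist_nonneg (x := z) (y := y)]
  refine LipschitzWith.of_dist_le_mul fun x y => ?_
  rcases le_or_gt ‖x‖ 1 with hx | hx <;> rcases le_or_gt ‖y‖ 1 with hy | hy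
  · rw [hin x hx, hin y hy]
    exact hf.dist_le_mul x (by simpa using hx) y (by simpa using hy)
  · exact cross x y hx hy
  · rw [dist_comm, dist_comm x]; exact cross y x hy hx
  · rw [hout x hx, hout y hy, dist_self]; positivity

open MeasureTheory Metric Set Filter Topology in
theorem not_contDiff_retraction {E : Type*} [NormedAddCommGroup E] [InnerProductSpace ℝ E]
    [FiniteDimensional ℝ E] {r : E → E} (hr : ContDiff ℝ 1 r) (h1 : ∀ x, ‖r x‖ = 1)
    (hs : ∀ x, ‖x‖ = 1 → r x = x) : False := by
  classical
  let _ : MeasurableSpace E := borel E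
  have _ : BorelSpace E := ⟨rfl⟩
  let A : E → E →L[ℝ] E := fun x => fderiv ℝ r x - 1
  have hA : Continuous A := (hr.continuous_fderiv one_ne_zero).sub continuous_const
  have hrd : ∀ x, HasFDerivAt r (fderiv ℝ r x) x :=
    fun x => (hr.differentiable one_ne_zero x).hasFDerivAt
  obtain ⟨L, hL⟩ := ((hr.sub contDiff_id).contDiffOn (s := closedBall (0 : E) 1)).exists_lipschitzOnWith
    one_ne_zero (convex_closedBall 0 1) (isCompact_closedBall 0 1)
  let u : E → E := fun x => if ‖x‖ ≤ 1 then r x - x else 0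
  have hu : LipschitzWith L u := hL.extend_zero (fun x hx => by simp [hs x hx])
    (fun x hx => by simp [u, hx]) (fun x hx => by simp [u, not_le.2 hx])
  have hdetc : Continuous fun q : ℝ × E => (1 + q.1 • A q.2).det :=
    ContinuousLinearMap.continuous_det.comp
      (continuous_const.add (continuous_fst.smul (hA.comp continuous_snd)))
  have hpos : ∀ᶠ t : ℝ in 𝓝 0, ∀ x ∈ closedBall (0 : E) 1, 0 < (1 + t • A x).det := by
    refine (isCompact_closedBall (0 : E) 1).eventually_forall_of_forall_eventually ?_
    intro y _
    refine hdetc.continuousAt.eventually (lt_mem_nhds ?_)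
    have : (1 : E →L[ℝ] E).det = 1 := by
      simp [ContinuousLinearMap.det]
    simp [this]
  obtain ⟨ε, hε, hεpos⟩ := Metric.eventually_nhds_iff.1 hpos
  let δ : ℝ := min ε (1 / (L + 1))
  have hδ : 0 < δ := lt_min hε (by positivity)
  let B : Set E := ball 0 1
  have hvol : ∀ t, 0 < t → t < δ → ∫ x in B, (1 + t • A x).det = volume.real B := by
    intro t ht htδ
    let f : E → E := fun x => x + t • u x
    have hap : ApproximatesLinearOn f ((ContinuousLinearEquiv.refl ℝ E : E ≃L[ℝ] E) : E →L[ℝ] E)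
        univ (t.toNNReal * L) := by
      rw [ApproximatesLinearOn.approximatesLinearOn_iff_lipschitzOnWith, lipschitzOnWith_univ]
      refine LipschitzWith.of_dist_le_mul fun x y => ?_
      have := hu.dist_le_mul x y
      simp only [f, Pi.sub_apply, ContinuousLinearEquiv.coe_coe, ContinuousLinearEquiv.refl_apply,
        add_sub_cancel_left, dist_smul₀, NNReal.coe_mul, Real.coe_toNNReal _ ht.le, Real.norm_eq_abs,
        abs_of_pos ht, mul_assoc]
      gcongr
    have hc : Subsingleton E ∨ t.toNNReal * L <
        ‖((ContinuousLinearEquiv.refl ℝ E).symm : E →L[ℝ] E)‖₊⁻¹ := by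
      rcases subsingleton_or_nontrivial E with h | h
      · exact Or.inl h
      right
      have : ‖((ContinuousLinearEquiv.refl ℝ E).symm : E →L[ℝ] E)‖₊ = 1 := by
        have : ((ContinuousLinearEquiv.refl ℝ E).symm : E →L[ℝ] E) = ContinuousLinearMap.id ℝ E := rfl
        rw [this]; ext; simp
      rw [this, inv_one, ← NNReal.coe_lt_coe]
      simp only [NNReal.coe_mul, Real.coe_toNNReal _ ht.le, NNReal.coe_one]
      have h2 : t < 1 / (L + 1) := htδ.trans_le (min_le_right _ _)
      rw [lt_div_iff₀ (by positivity)] at h2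
      nlinarith
    have hbij : Function.Bijective f :=
      ⟨injOn_univ.1 (hap.injOn hc), hap.surjective hc⟩
    have himg : f '' B = B := by
      have hout : ∀ x, x ∈ Bᶜ → f x = x := by
        intro x hx
        have hx' : 1 ≤ ‖x‖ := by simpa [B] using hx
        rcases hx'.eq_or_lt with h | h
        · simp [f, u, hs x h.symm]
        · simp [f, u, not_le.2 h]
      have hcompl : f '' Bᶜ = Bᶜ := by
        rw [image_congr hout, image_id']
      rw [image_compl_eq hbij] at hcompl
      exact compl_injective hcompl
    have hder : ∀ x ∈ B, HasFDerivWithinAt f (1 + t • A x) B x := by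
      intro x hx
      have hB : ∀ᶠ y in 𝓝 x, f y = y + t • (r y - y) := by
        filter_upwards [isOpen_ball.mem_nhds hx] with y hy
        have : ‖y‖ ≤ 1 := by simpa using (mem_ball.1 hy).le
        simp [f, u, this]
      refine (HasFDerivAt.congr_of_eventuallyEq ?_ hB).hasFDerivWithinAt
      exact (hasFDerivAt_id x).add (((hrd x).sub (hasFDerivAt_id x)).const_smul t)
    have := integral_image_eq_integral_abs_det_fderiv_smul volume measurableSet_ball hder
      hbij.1.injOn (fun _ => (1 : ℝ))
    rw [himg] at this
    simp only [integral_const, measureReal_restrict_apply_univ, smul_eq_mul, mul_one] at this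
    rw [this]
    refine setIntegral_congr_fun measurableSet_ball fun x hx => ?_
    have : 0 < (1 + t • A x).det := by
      refine hεpos ?_ x (ball_subset_closedBall hx)
      simpa [abs_of_pos ht] using htδ.trans_le (min_le_left _ _)
    simp [abs_of_pos this]
  have hzero : ∀ x, (1 + A x).det = 0 := by
    intro x
    have hAx : 1 + A x = fderiv ℝ r x := by simp [A]
    rw [hAx]
    by_contra hne
    have horth : ∀ v, inner ℝ (fderiv ℝ r x v) (r x) = 0 := by
      intro v
      have hd := (hrd x).inner ℝ (hrd x)
      have hconst : (fun y => inner ℝ (r y) (r y)) = fun _ => (1 : ℝ) := by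
        ext y; rw [real_inner_self_eq_norm_sq, h1]; norm_num
      rw [hconst] at hd
      have h0 := congrArg (fun T : E →L[ℝ] ℝ => T v) (hd.unique (hasFDerivAt_const (1 : ℝ) x))
      simp only [ContinuousLinearMap.comp_apply, ContinuousLinearMap.prod_apply,
        fderivInnerCLM_apply, zero_apply] at h0
      rw [real_inner_comm (fderiv ℝ r x v) (r x)] at h0
      rw [real_inner_comm] at h0
      rw [real_inner_comm]
      linarith
    obtain ⟨v, hv⟩ := ((fderiv ℝ r x : E →ₗ[ℝ] E).equivOfDetNeZero hne).surjective (r x)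
    have hv' : fderiv ℝ r x v = r x := hv
    have := horth v
    rw [hv', real_inner_self_eq_norm_sq, h1] at this
    norm_num at this
  obtain ⟨s, v, w, hv, hw⟩ := exists_det_one_add_eq_sum (E := E) hδ
  have hint : ∀ t : ℝ, IntegrableOn (fun x => (1 + t • A x).det) B volume := by
    intro t
    have : Continuous fun x => (1 + t • A x).det := hdetc.comp (Continuous.prodMk_right t)
    exact (this.continuousOn.integrableOn_compact (isCompact_closedBall (0 : E) 1)).mono_set
      ball_subset_closedBall
  have hsum : ∑ i ∈ s, w i = 1 := by
    have := hw 0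
    have h1 : (1 : E →L[ℝ] E).det = 1 := by simp [ContinuousLinearMap.det]
    simpa [h1] using this.symm
  have : (0 : ℝ) = volume.real B := by
    calc (0 : ℝ) = ∫ x in B, (1 + A x).det := by
          rw [show (fun x => (1 + A x).det) = fun _ => (0 : ℝ) from funext hzero, integral_zero]
      _ = ∫ x in B, ∑ i ∈ s, (1 + v i • A x).det * w i := by
          congr 1; ext x; exact hw (A x)
      _ = ∑ i ∈ s, ∫ x in B, (1 + v i • A x).det * w i :=
          integral_finsetSum _ fun i _ => (hint _).mul_const _
      _ = ∑ i ∈ s, volume.real B * w i := by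
          refine Finset.sum_congr rfl fun i _ => ?_
          rw [integral_mul_const, hvol _ (hv i).1 (hv i).2]
      _ = volume.real B := by rw [← Finset.mul_sum, hsum, mul_one]
  have hp : 0 < volume.real B :=
    ENNReal.toReal_pos (measure_ball_pos volume 0 one_pos).ne' measure_ball_lt_top.ne
  exact hp.ne this

open MeasureTheory Metric Set Filter Topology in
/-- A continuous self-map of a Euclidean space which is the identity near infinity has a zero. -/
theorem exists_zero_of_eq_id_outside {E : Type*} [NormedAddCommGroup E] [InnerProductSpace ℝ E]
    [FiniteDimensional ℝ E] {K : E → E} (hK : Continuous K) {R : ℝ}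
    (hid : ∀ x, R ≤ ‖x‖ → K x = x) : ∃ x, K x = 0 := by
  by_contra! hne
  set ρ : ℝ := max R 0 + 1 with hρ
  have hρ0 : 0 < ρ := by positivity
  have hRρ : R < ρ := (le_max_left R 0).trans_lt (lt_add_one _)
  obtain ⟨g, hg, hgK, hgS, -⟩ := hK.exists_contDiff_approx_and_eqOn 1 hK.norm
    (fun x => norm_pos_iff.2 (hne x)) (S := {x | ρ ≤ ‖x‖}) (U := {x | R < ‖x‖})
    (isClosed_le continuous_const continuous_norm)
    ((isOpen_lt continuous_const continuous_norm).mem_nhdsSet.2 fun x hx => hRρ.trans_le hx)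
    (contDiff_id.contDiffOn.congr fun x hx => hid x (le_of_lt hx))
  have hg0 : ∀ x, g x ≠ 0 := by
    intro x h
    have := hgK x
    rw [h, dist_zero_left] at this
    exact this.false
  have hn0 : ∀ x, ‖g (ρ • x)‖ ≠ 0 := fun x => norm_ne_zero_iff.2 (hg0 _)
  have hgs : ContDiff ℝ 1 fun x => g (ρ • x) := hg.comp (contDiff_id.const_smul ρ)
  refine not_contDiff_retraction (r := fun x => ‖g (ρ • x)‖⁻¹ • g (ρ • x))
    (((hgs.norm ℝ fun x => hg0 _).inv hn0).smul hgs) (fun x => ?_) (fun x hx => ?_)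
  · rw [norm_smul, norm_inv, norm_norm, inv_mul_cancel₀ (hn0 x)]
  · have h1 : ‖ρ • x‖ = ρ := by rw [norm_smul, hx, mul_one, Real.norm_of_nonneg hρ0.le]
    have h2 : g (ρ • x) = ρ • x := by
      rw [hgS (show ρ ≤ ‖ρ • x‖ from h1.ge), hid _ (h1.symm ▸ hRρ.le)]
    simp only [h2, h1, smul_smul, inv_mul_cancel₀ hρ0.ne', one_smul]

open Metric Set Filter Topology in
/-- The Poincaré–Miranda theorem. -/
theorem exists_zero_of_sign_on_cube {ι : Type*} [Fintype ι] {G : (ι → ℝ) → ι → ℝ}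
    (hG : ContinuousOn G (Icc (-1) 1))
    (h1 : ∀ x ∈ Icc (-1 : ι → ℝ) 1, ∀ i, x i = 1 → 0 < G x i)
    (h2 : ∀ x ∈ Icc (-1 : ι → ℝ) 1, ∀ i, x i = -1 → G x i < 0) :
    ∃ x ∈ Icc (-1 : ι → ℝ) 1, G x = 0 := by
  let P : (ι → ℝ) → ι → ℝ := fun x i => max (-1) (min 1 (x i))
  have hPc : Continuous P := by fun_prop
  have hPQ : ∀ x, P x ∈ Icc (-1 : ι → ℝ) 1 := fun x =>
    ⟨fun i => le_max_left _ _, fun i => max_le (by norm_num) (min_le_left _ _)⟩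
  have hGP : Continuous fun x => G (P x) := hG.comp_continuous hPc hPQ
  obtain ⟨M, hM⟩ := isCompact_Icc.exists_bound_of_continuousOn (hG.sub continuousOn_id)
  have hM0 : 0 ≤ M := (norm_nonneg _).trans (hM _ (hPQ 0))
  let K : (ι → ℝ) → ι → ℝ := fun x => x + max 0 (min 1 (M + 2 - ‖x‖)) • (G (P x) - P x)
  have hKc : Continuous K :=
    continuous_id.add ((show Continuous fun x : ι → ℝ => max 0 (min 1 (M + 2 - ‖x‖)) by
      fun_prop).smul (hGP.sub hPc))
  let e := EuclideanSpace.equiv ι ℝ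
  have hfar : ∀ x : EuclideanSpace ℝ ι, ‖(e.symm : (ι → ℝ) →L[ℝ] EuclideanSpace ℝ ι)‖ * (M + 2) + 1 ≤ ‖x‖ →
      e.symm (K (e x)) = x := by
    intro x hx
    have h3 : M + 2 ≤ ‖e x‖ := by
      by_contra! hlt
      have h4 := (e.symm : (ι → ℝ) →L[ℝ] EuclideanSpace ℝ ι).le_opNorm (e x)
      rw [ContinuousLinearEquiv.coe_coe, e.symm_apply_apply] at h4
      have := mul_le_mul_of_nonneg_left hlt.le (norm_nonneg (e.symm : (ι → ℝ) →L[ℝ] EuclideanSpace ℝ ι))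
      linarith
    have h5 : max 0 (min 1 (M + 2 - ‖e x‖)) = 0 :=
      max_eq_left ((min_le_right _ _).trans (by linarith))
    simp only [K, h5, zero_smul, add_zero, e.symm_apply_apply]
  obtain ⟨x', hx'⟩ := exists_zero_of_eq_id_outside
    (e.symm.continuous.comp (hKc.comp e.continuous)) hfar
  have hx : K (e x') = 0 := e.symm.injective (by simpa using hx')
  generalize e x' = x at hx
  have hxM : ‖x‖ ≤ M := by
    have h3 : ‖x‖ = max 0 (min 1 (M + 2 - ‖x‖)) * ‖G (P x) - P x‖ := by
      have : x = -(max 0 (min 1 (M + 2 - ‖x‖)) • (G (P x) - P x)) := eq_neg_of_add_eq_zero_left hx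
      conv_lhs => rw [this]
      rw [norm_neg, norm_smul, Real.norm_of_nonneg (le_max_left _ _)]
    rw [h3]
    have h4 : ‖G (P x) - P x‖ ≤ M := hM _ (hPQ x)
    have h5 : max 0 (min 1 (M + 2 - ‖x‖)) ≤ 1 := max_le zero_le_one (min_le_left _ _)
    have h6 := norm_nonneg (G (P x) - P x)
    nlinarith
  have hone : max 0 (min 1 (M + 2 - ‖x‖)) = 1 := by
    rw [min_eq_left (by linarith), max_eq_right zero_le_one]
  have hsum : ∀ i, x i + (G (P x) i - P x i) = 0 := by
    intro i
    have := congrFun hx i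
    simpa [K, hone] using this
  have hPx : P x = x := by
    ext i
    have hs := hsum i
    rcases lt_trichotomy (x i) (-1) with h | h | h
    · have hp : P x i = -1 := by simp only [P]; rw [min_eq_right (by linarith), max_eq_left h.le]
      have := h2 _ (hPQ x) i hp
      linarith
    · simp only [P, h]; norm_num
    · rcases le_or_gt (x i) 1 with h' | h'
      · simp only [P]; rw [min_eq_right h', max_eq_right h.le]
      · have hp : P x i = 1 := by simp only [P]; rw [min_eq_left h'.le]; norm_num
        have := h1 _ (hPQ x) i hp
        linarith
  refine ⟨x, hPx ▸ hPQ x, ?_⟩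
  ext i
  have := hsum i
  rw [hPx] at this
  simpa using this

open Metric Set Filter Topology in
/-- On a compact space which embeds in a subset of Hausdorff dimension less than `d`, every map to
`ℝ^d` can be made nowhere zero without changing it on a closed set where it has no zeros. -/
theorem exists_nonvanishing_eqOn {Z V ι : Type*} [TopologicalSpace Z] [CompactSpace Z]
    [NormedAddCommGroup V] [NormedSpace ℝ V] [FiniteDimensional ℝ V] [Fintype ι]
    {j : Z → V} (hj : Continuous j) (hinj : Function.Injective j)
    (hdim : Nonempty Z → dimH (range j) < Fintype.card ι)
    {f : Z → ι → ℝ} (hf : Continuous f) {A : Set Z} (hA : IsClosed A)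
    (h0 : ∀ a ∈ A, f a ≠ 0) :
    ∃ F : Z → ι → ℝ, Continuous F ∧ (∀ a ∈ A, F a = f a) ∧ ∀ z, F z ≠ 0 := by
  rcases isEmpty_or_nonempty Z with hZ | hZ
  · exact ⟨f, hf, fun _ _ => rfl, fun z => (hZ.false z).elim⟩
  obtain ⟨δ, hδ, hδA⟩ : ∃ δ > 0, ∀ a ∈ A, δ ≤ ‖f a‖ := by
    rcases A.eq_empty_or_nonempty with rfl | hne
    · exact ⟨1, one_pos, by simp⟩
    · obtain ⟨a, ha, hmin⟩ := hA.isCompact.exists_isMinOn hne hf.norm.continuousOn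
      exact ⟨‖f a‖, norm_pos_iff.2 (h0 a ha), fun b hb => hmin hb⟩
  obtain ⟨f', hf'⟩ := ContinuousMap.exists_extension' (hj.isClosedEmbedding hinj) ⟨f, hf⟩
  have hf'j : ∀ z, f' (j z) = f z := fun z => congrFun hf' z
  obtain ⟨g, hg, hgf, -⟩ := f'.continuous.exists_contDiff_approx 1
    (ε := fun _ => δ / 8) continuous_const (fun _ => by positivity)
  have hdense : Dense (g '' range j)ᶜ := by
    refine ContDiffOn.dense_compl_image_of_dimH_lt_finrank (s := univ) hg.contDiffOn convex_univ
      (subset_univ _) ?_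
    rw [Module.finrank_fintype_fun_eq_card]
    exact hdim hZ
  obtain ⟨c, hc, hcδ⟩ := hdense.exists_dist_lt 0 (show 0 < δ / 8 by positivity)
  rw [dist_zero_left] at hcδ
  let G : Z → ι → ℝ := fun z => g (j z) - c
  have hGc : Continuous G := (hg.continuous.comp hj).sub continuous_const
  have hG0 : ∀ z, G z ≠ 0 := fun z h => hc ⟨j z, mem_range_self z, sub_eq_zero.1 h⟩
  have hGf : ∀ z, ‖G z - f z‖ ≤ δ / 4 := by
    intro z
    have h1 := hgf (j z)
    rw [hf'j, dist_eq_norm] at h1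
    have h2 : G z - f z = (g (j z) - f z) - c := by simp only [G]; abel
    rw [h2]
    refine (norm_sub_le _ _).trans ?_
    linarith
  let l : Z → ℝ := fun z => max 0 (min 1 (2 * ‖f z‖ / δ - 1))
  have hl : Continuous l := by fun_prop
  refine ⟨fun z => G z + l z • (f z - G z), by fun_prop, fun a ha => ?_, fun z (hz : G z + l z • (f z - G z) = 0) => ?_⟩
  · have : l a = 1 := by
      have : 1 ≤ 2 * ‖f a‖ / δ - 1 := by
        rw [le_sub_iff_add_le, le_div_iff₀ hδ]
        linarith [hδA a ha]
      simp only [l]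
      rw [min_eq_left this, max_eq_right zero_le_one]
    simp only [this, one_smul, add_sub_cancel]
  · rcases le_or_gt ‖f z‖ (δ / 2) with h | h
    · have hl0 : l z = 0 := by
        have : 2 * ‖f z‖ / δ - 1 ≤ 0 := by
          rw [sub_nonpos, div_le_iff₀ hδ]
          linarith
        exact max_eq_left ((min_le_right _ _).trans this)
      rw [hl0, zero_smul, add_zero] at hz
      exact hG0 z hz
    · have h1 : f z = (l z - 1) • (G z - f z) := by
        calc f z = f z - (G z + l z • (f z - G z)) := by rw [hz, sub_zero]
          _ = _ := by module
      have h2 : ‖f z‖ ≤ δ / 4 := by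
        rw [h1, norm_smul]
        have h3 : ‖l z - 1‖ ≤ 1 := by
          rw [Real.norm_eq_abs, abs_le]
          constructor
          · linarith [show 0 ≤ l z from le_max_left _ _]
          · linarith [show l z ≤ 1 from max_le zero_le_one (min_le_left _ _)]
        calc ‖l z - 1‖ * ‖G z - f z‖ ≤ 1 * (δ / 4) :=
              mul_le_mul h3 (hGf z) (norm_nonneg _) zero_le_one
          _ = δ / 4 := one_mul _
      linarith

open Metric Set Filter Topology in
/-- A cube does not embed in a space of smaller dimension. -/
theorem card_le_finrank_of_cube_embedding {V ι : Type*} [NormedAddCommGroup V] [NormedSpace ℝ V]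
    [FiniteDimensional ℝ V] [Fintype ι] {j : (ι → ℝ) → V}
    (hj : ContinuousOn j (Icc (-1) 1)) (hinj : InjOn j (Icc (-1) 1)) :
    Fintype.card ι ≤ Module.finrank ℝ V := by
  by_contra! hlt
  let Q : Set (ι → ℝ) := Icc (-1) 1
  have : CompactSpace Q := isCompact_iff_compactSpace.1 isCompact_Icc
  have hdim : dimH (range fun z : Q => j z) < Fintype.card ι := by
    calc _ ≤ dimH (univ : Set V) := dimH_mono (subset_univ _)
      _ = Module.finrank ℝ V := Real.dimH_univ_eq_finrank V
      _ < _ := by exact_mod_cast hlt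
  obtain ⟨F, hF, hFA, hF0⟩ := exists_nonvanishing_eqOn (Z := Q) (j := fun z => j z)
    (continuousOn_iff_continuous_domRestrict.1 hj) (injOn_iff_injective.1 hinj) (fun _ => hdim)
    (f := fun z => z) continuous_subtype_val (A := ⋃ i, {z : Q | |(z : ι → ℝ) i| = 1})
    (isClosed_iUnion_of_finite fun i => isClosed_eq
      ((continuous_apply i).comp continuous_subtype_val).abs continuous_const)
    (by
      rintro a ha h
      obtain ⟨i, hi⟩ := mem_iUnion.1 ha
      have : |(a : ι → ℝ) i| = 1 := hi
      simp [h] at this)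
  obtain ⟨F', hF'⟩ := ContinuousMap.exists_restrict_eq (isClosed_Icc : IsClosed Q) ⟨F, hF⟩
  have hFF' : ∀ x (hx : x ∈ Q), F' x = F ⟨x, hx⟩ := fun x hx => DFunLike.congr_fun hF' ⟨x, hx⟩
  have hbd : ∀ x ∈ Q, ∀ i, |x i| = 1 → F' x = x := fun x hx i hi => by
    rw [hFF' x hx, hFA _ (mem_iUnion.2 ⟨i, hi⟩)]
  obtain ⟨x, hx, hx0⟩ := exists_zero_of_sign_on_cube F'.continuous.continuousOn
    (fun x hx i hi => by rw [hbd x hx i (by simp [hi]), hi]; norm_num)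
    (fun x hx i hi => by rw [hbd x hx i (by simp [hi]), hi]; norm_num)
  exact hF0 ⟨x, hx⟩ ((hFF' x hx).symm.trans hx0)

open Metric Set Filter Topology in
/-- A closed set of codimension at least two does not separate a convex open set. The codimension
is measured after an embedding `j` into some finite-dimensional space. -/
theorem not_separated_of_dimH_lt {κ V : Type*} [Fintype κ] [NormedAddCommGroup V]
    [NormedSpace ℝ V] [FiniteDimensional ℝ V] {O A B : Set (κ → ℝ)} (hO : IsOpen O)
    (hOc : Convex ℝ O) (hA : IsClosed A) (hB : IsClosed B) (hcov : O ⊆ A ∪ B)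
    {j : (κ → ℝ) → V} (hj : ContinuousOn j (A ∩ B)) (hinj : InjOn j (A ∩ B))
    (hdim : (A ∩ B).Nonempty → dimH (j '' (A ∩ B)) + 1 < Fintype.card κ)
    {p q : κ → ℝ} (hp : p ∈ O \ B) (hq : q ∈ O \ A) : False := by
  classical
  have hpA : p ∈ A := (hcov hp.1).resolve_right hp.2
  have hqB : q ∈ B := (hcov hq.1).resolve_left hq.2
  obtain ⟨k, hk⟩ : ∃ k, p k ≠ q k := by
    by_contra! h
    exact hq.2 (funext h ▸ hpA)
  obtain ⟨r₁, hr₁, hr₁B⟩ := Metric.isOpen_iff.1 (hO.sdiff hB) p hp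
  obtain ⟨r₂, hr₂, hr₂A⟩ := Metric.isOpen_iff.1 (hO.sdiff hA) q hq
  let ε : ℝ := min r₁ r₂ / 2
  have hm : 0 < min r₁ r₂ := lt_min hr₁ hr₂
  have hε : 0 < ε := half_pos hm
  have hε₁ : ε < r₁ := (half_lt_self hm).trans_le (min_le_left _ _)
  have hε₂ : ε < r₂ := (half_lt_self hm).trans_le (min_le_right _ _)
  let w : (κ → ℝ) → κ → ℝ := fun x => ε • Function.update x k 0
  let c : (κ → ℝ) → κ → ℝ := fun x =>
    ((1 - x k) / 2) • (p + w x) + ((1 + x k) / 2) • (q + w x)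
  have hwc : Continuous w := (continuous_id.update k continuous_const).const_smul ε
  have hcc : Continuous c := by fun_prop
  let Q : Set (κ → ℝ) := Icc (-1) 1
  have hQ : IsCompact Q := isCompact_Icc
  have hw : ∀ x ∈ Q, ‖w x‖ ≤ ε := by
    intro x hx
    have : ‖Function.update x k 0‖ ≤ 1 := by
      refine (pi_norm_le_iff_of_nonneg zero_le_one).2 fun i => ?_
      by_cases h : i = k
      · subst h; simp
      · rw [Function.update_of_ne h, Real.norm_eq_abs, abs_le]
        exact ⟨hx.1 i, hx.2 i⟩
    rw [norm_smul, Real.norm_of_nonneg hε.le]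
    nlinarith
  have hpw : ∀ x ∈ Q, p + w x ∈ O \ B := fun x hx => hr₁B (by
    rw [mem_ball, dist_self_add_left]; exact (hw x hx).trans_lt hε₁)
  have hqw : ∀ x ∈ Q, q + w x ∈ O \ A := fun x hx => hr₂A (by
    rw [mem_ball, dist_self_add_left]; exact (hw x hx).trans_lt hε₂)
  have hcO : ∀ x ∈ Q, c x ∈ O := by
    intro x hx
    have h1 : -1 ≤ x k := hx.1 k
    have h2 : x k ≤ 1 := hx.2 k
    exact hOc (hpw x hx).1 (hqw x hx).1 (by linarith) (by linarith) (by ring)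
  have hcinj : Function.Injective c := by
    intro x y hxy
    have hck : ∀ x, c x k = p k + (1 + x k) / 2 * (q k - p k) := by
      intro x
      simp only [c, w, Pi.add_apply, Pi.smul_apply, Function.update_self, smul_eq_mul]
      ring
    have hkk : x k = y k := by
      have := congrFun hxy k
      rw [hck, hck] at this
      have h3 : (x k - y k) * (q k - p k) = 0 := by linarith
      rcases mul_eq_zero.1 h3 with h | h
      · linarith
      · exact absurd (by linarith) hk
    ext i
    by_cases h : i = k
    · subst h; exact hkk
    · have := congrFun hxy i
      simp only [c, w, Pi.add_apply, Pi.smul_apply, Function.update_of_ne h, smul_eq_mul, hkk] at this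
      have h3 : ε * (x i - y i) = 0 := by linarith
      rcases mul_eq_zero.1 h3 with h4 | h4
      · exact absurd h4 hε.ne'
      · linarith
  let s : (κ → ℝ) → ℝ := fun x => infDist (c x) A - infDist (c x) B
  have hs : Continuous s :=
    ((continuous_infDist_pt A).comp hcc).sub ((continuous_infDist_pt B).comp hcc)
  have hs1 : ∀ x ∈ Q, x k = 1 → 0 < s x := by
    intro x hx h
    have hcx : c x = q + w x := by
      simp only [c, h]; norm_num
    have hm := hqw x hx
    rw [← hcx] at hm
    have h1 := (hA.notMem_iff_infDist_pos ⟨p, hpA⟩).1 hm.2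
    have h2 := infDist_zero_of_mem ((hcov hm.1).resolve_left hm.2)
    simp only [s, h2]; linarith
  have hs2 : ∀ x ∈ Q, x k = -1 → s x < 0 := by
    intro x hx h
    have hcx : c x = p + w x := by
      simp only [c, h]; norm_num
    have hm := hpw x hx
    rw [← hcx] at hm
    have h1 := (hB.notMem_iff_infDist_pos ⟨q, hqB⟩).1 hm.2
    have h2 := infDist_zero_of_mem ((hcov hm.1).resolve_right hm.2)
    simp only [s, h2]; linarith
  have hs0 : ∀ x ∈ Q, s x = 0 → c x ∈ A ∩ B := by
    intro x hx h
    have h' : infDist (c x) A = infDist (c x) B := sub_eq_zero.1 h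
    rcases hcov (hcO x hx) with h1 | h1
    · exact ⟨h1, (hB.mem_iff_infDist_zero ⟨q, hqB⟩).2 (h' ▸ infDist_zero_of_mem h1)⟩
    · exact ⟨(hA.mem_iff_infDist_zero ⟨p, hpA⟩).2 (h'.trans (infDist_zero_of_mem h1)), h1⟩
  let Z : Set (κ → ℝ) := Q ∩ c ⁻¹' (A ∩ B)
  have hZ : IsCompact Z := hQ.inter_right ((hA.inter hB).preimage hcc)
  have : CompactSpace Z := isCompact_iff_compactSpace.1 hZ
  let y : (κ → ℝ) → {i // i ≠ k} → ℝ := fun x i => x i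
  have hy : Continuous y := by fun_prop
  let S : Set (κ → ℝ) := ⋃ i : {i // i ≠ k}, {x | |x i| = 1}
  have hS : IsClosed S := isClosed_iUnion_of_finite fun i =>
    isClosed_eq (continuous_apply _).abs continuous_const
  obtain ⟨F, hF, hFS, hF0⟩ := exists_nonvanishing_eqOn (Z := Z) (j := fun z => j (c z))
    (hj.comp_continuous (hcc.comp continuous_subtype_val) fun z => z.2.2)
    (fun a b hab => Subtype.ext (hcinj (hinj a.2.2 b.2.2 hab)))
    (fun ⟨z⟩ => by
      have h1 := hdim ⟨c z, z.2.2⟩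
      have h2 : Fintype.card κ = Fintype.card {i // i ≠ k} + 1 := by
        rw [Fintype.card_subtype_compl, Fintype.card_subtype_eq,
          Nat.sub_add_cancel (Fintype.card_pos_iff.2 ⟨k⟩)]
      rw [h2, Nat.cast_add, Nat.cast_one] at h1
      refine (dimH_mono ?_).trans_lt (lt_of_add_lt_add_right h1)
      rintro _ ⟨a, rfl⟩
      exact ⟨c a, a.2.2, rfl⟩)
    (f := fun z => y z) (hy.comp continuous_subtype_val) (A := Subtype.val ⁻¹' S)
    (hS.preimage continuous_subtype_val)
    (by
      rintro a ha h
      obtain ⟨i, hi⟩ := mem_iUnion.1 ha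
      have h3 : |(a : κ → ℝ) i| = 1 := hi
      have h4 : (a : κ → ℝ) i = 0 := congrFun h i
      simp [h4] at h3)
  let F₁ : (κ → ℝ) → {i // i ≠ k} → ℝ := fun x => if h : x ∈ Z then F ⟨x, h⟩ else y x
  have hF₁Z : ∀ x (h : x ∈ Z), F₁ x = F ⟨x, h⟩ := fun x h => dif_pos h
  have hF₁S : ∀ x ∈ S, F₁ x = y x := by
    intro x hx
    by_cases h : x ∈ Z
    · rw [hF₁Z x h]; exact hFS ⟨x, h⟩ hx
    · exact dif_neg h
  have hF₁ : ContinuousOn F₁ (Z ∪ S) := by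
    refine ContinuousOn.union_of_isClosed ?_ (hy.continuousOn.congr hF₁S) hZ.isClosed hS
    rw [continuousOn_iff_continuous_domRestrict]
    convert hF using 1
    ext1 x
    exact hF₁Z x x.2
  obtain ⟨F₂, hF₂⟩ := ContinuousMap.exists_restrict_eq (hZ.isClosed.union hS)
    ⟨_, continuousOn_iff_continuous_domRestrict.1 hF₁⟩
  have hF₂' : ∀ x ∈ Z ∪ S, F₂ x = F₁ x := fun x hx => DFunLike.congr_fun hF₂ ⟨x, hx⟩
  have hside : ∀ x (i : κ) (hi : i ≠ k), |x i| = 1 → F₂ x ⟨i, hi⟩ = x i := by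
    intro x i hi h
    have hxS : x ∈ S := mem_iUnion.2 ⟨⟨i, hi⟩, h⟩
    rw [hF₂' x (Or.inr hxS), hF₁S x hxS]
  let G : (κ → ℝ) → κ → ℝ := fun x i => if h : i = k then s x else F₂ x ⟨i, h⟩
  have hG : Continuous G := by
    refine continuous_pi fun i => ?_
    by_cases h : i = k
    · simpa only [G, h, dite_true] using hs
    · simp only [G, h, dite_false]
      exact (continuous_apply _).comp F₂.continuous
  have hGk : ∀ x, G x k = s x := fun x => dif_pos rfl
  have hGi : ∀ x i (h : i ≠ k), G x i = F₂ x ⟨i, h⟩ := fun x i h => dif_neg h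
  obtain ⟨x, hx, hx0⟩ := exists_zero_of_sign_on_cube hG.continuousOn
    (fun x hx i hi => by
      by_cases h : i = k
      · subst h; rw [hGk]; exact hs1 x hx hi
      · rw [hGi x i h, hside x i h (by simp [hi]), hi]; norm_num)
    (fun x hx i hi => by
      by_cases h : i = k
      · subst h; rw [hGk]; exact hs2 x hx hi
      · rw [hGi x i h, hside x i h (by simp [hi]), hi]; norm_num)
  have hxZ : x ∈ Z := ⟨hx, hs0 x hx ((hGk x).symm.trans (congrFun hx0 k))⟩
  refine hF0 ⟨x, hxZ⟩ ?_
  ext ⟨i, hi⟩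
  rw [← hF₁Z x hxZ, ← hF₂' x (Or.inl hxZ), ← hGi x i hi, hx0]
  rfl

/-- Concatenating two paths which only meet at the common endpoint yields a path. -/
theorem SimpleGraph.Walk.IsPath.append_of_inter_eq {V : Type*} {G : SimpleGraph V} {u v w : V}
    {p : G.Walk u v} {q : G.Walk v w} (hp : p.IsPath) (hq : q.IsPath)
    (h : ∀ z ∈ p.support, z ∈ q.support → z = v) : (p.append q).IsPath := by
  rw [SimpleGraph.Walk.isPath_def, SimpleGraph.Walk.support_append]
  have hq' := hq.support_nodup
  rw [← SimpleGraph.Walk.cons_tail_support, List.nodup_cons] at hq'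
  refine hp.support_nodup.append hq'.2 fun z hz hz' => ?_
  have := h z hz (by rw [← SimpleGraph.Walk.cons_tail_support]; exact List.mem_cons_of_mem _ hz')
  exact hq'.1 (this ▸ hz')

/-- In a forest, every path between two vertices of a set which induces a connected subgraph stays
inside that set. -/
theorem SimpleGraph.IsAcyclic.mem_of_mem_support {V : Type*} {G : SimpleGraph V}
    (hG : G.IsAcyclic) {S : Set V} (hS : (G.induce S).Preconnected) {x y : V} (hx : x ∈ S)
    (hy : y ∈ S) {q : G.Walk x y} (hq : q.IsPath) {z : V} (hz : z ∈ q.support) : z ∈ S := by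
  classical
  obtain ⟨p⟩ := hS ⟨x, hx⟩ ⟨y, hy⟩
  have hpath := p.bypass_isPath.map (f := (SimpleGraph.Embedding.induce (G := G) S).toHom)
    (SimpleGraph.Embedding.induce (G := G) S).injective
  have hsub : ∀ z ∈ (p.bypass.map (SimpleGraph.Embedding.induce (G := G) S).toHom).support,
      z ∈ S := by
    intro z hz
    rw [SimpleGraph.Walk.support_map, List.mem_map] at hz
    obtain ⟨z', -, rfl⟩ := hz
    exact z'.2
  have heq : q = p.bypass.map (SimpleGraph.Embedding.induce (G := G) S).toHom :=
    congrArg Subtype.val ((hG.subsingleton_path x y).elim ⟨q, hq⟩ ⟨_, hpath⟩)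
  subst heq
  exact hsub z hz

/-- Any three vertices of a tree have a median: a vertex which lies in every set of vertices which
induces a connected subgraph and contains at least two of the three vertices. -/
theorem SimpleGraph.IsTree.exists_median {V : Type*} {G : SimpleGraph V} (hG : G.IsTree)
    (a b c : V) : ∃ m, ∀ S : Set V, (G.induce S).Preconnected →
      (a ∈ S ∧ b ∈ S ∨ b ∈ S ∧ c ∈ S ∨ a ∈ S ∧ c ∈ S) → m ∈ S := by
  classical
  obtain ⟨p₀⟩ := hG.connected.preconnected a b
  let p := p₀.bypass
  have hp : p.IsPath := p₀.bypass_isPath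
  have key : ∀ {c a : V}, G.Walk c a → a ∈ p.support → ∃ m ∈ p.support, ∃ q : G.Walk c m,
      ∀ z ∈ q.support, z ∈ p.support → z = m := by
    intro c a r
    induction r with
    | nil => exact fun h => ⟨_, h, .nil, by simp⟩
    | @cons u v w huv r ih =>
      intro h
      by_cases hu : u ∈ p.support
      · exact ⟨u, hu, .nil, by simp⟩
      · obtain ⟨m, hm, q, hq⟩ := ih h
        refine ⟨m, hm, .cons huv q, fun z hz hzp => ?_⟩
        rw [SimpleGraph.Walk.support_cons, List.mem_cons] at hz
        rcases hz with rfl | hz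
        · exact absurd hzp hu
        · exact hq z hz hzp
  obtain ⟨r⟩ := hG.connected.preconnected c a
  obtain ⟨m, hm, q, hq⟩ := key r p.start_mem_support
  have hqb : ∀ z ∈ q.bypass.support, z ∈ p.support → z = m := fun z hz =>
    hq z (q.support_bypass_subset_support hz)
  have h1 : (q.bypass.append (p.dropUntil m hm)).IsPath :=
    q.bypass_isPath.append_of_inter_eq (hp.dropUntil hm) fun z hz hz' =>
      hqb z hz (p.support_dropUntil_subset_support hm hz')
  have h2 : (q.bypass.append (p.takeUntil m hm).reverse).IsPath :=
    q.bypass_isPath.append_of_inter_eq (hp.takeUntil hm).reverse fun z hz hz' =>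
      hqb z hz (p.support_takeUntil_subset_support hm (by simpa using hz'))
  refine ⟨m, fun S hS => ?_⟩
  rintro (⟨ha, hb⟩ | ⟨hb, hc⟩ | ⟨ha, hc⟩)
  · exact hG.isAcyclic.mem_of_mem_support hS ha hb hp hm
  · exact hG.isAcyclic.mem_of_mem_support hS hc hb h1 (by simp)
  · exact hG.isAcyclic.mem_of_mem_support hS hc ha h2 (by simp)

open Metric Set in
/-- A point `v` of a convex body cannot be approached from two closed pieces which cover the body
near `v` and meet in codimension at least two. -/
theorem not_locally_separated_of_dimH_lt {κ V : Type*} [Fintype κ] [NormedAddCommGroup V]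
    [NormedSpace ℝ V] [FiniteDimensional ℝ V] {K : Set (κ → ℝ)} (hK : IsClosed K)
    (hKc : Convex ℝ K) (hKi : (interior K).Nonempty) {X A B R : Set V} (h : X ≃ₜ K)
    (hA : IsClosed A) (hB : IsClosed B) (hR : IsClosed R) (hcov : X ⊆ A ∪ B ∪ R)
    (hdim : dimH (A ∩ B) + 1 < Fintype.card κ) {v : V} (hvX : v ∈ X) (hvR : v ∉ R)
    (hvA : v ∈ closure (X \ (B ∪ R))) (hvB : v ∈ closure (X \ (A ∪ R))) : False := by
  classical
  let D : Set V → Set (κ → ℝ) := fun A => Subtype.val '' (h '' (Subtype.val ⁻¹' A))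
  have hD : ∀ {A}, IsClosed A → IsClosed (D A) := fun hA =>
    hK.isClosedMap_subtype_val _ (h.isClosedMap _ (hA.preimage continuous_subtype_val))
  have memD : ∀ {A} {x : X}, ((h x : K) : κ → ℝ) ∈ D A ↔ (x : V) ∈ A := by
    intro A x
    constructor
    · rintro ⟨_, ⟨x', hx', rfl⟩, he⟩
      rwa [← h.injective (Subtype.val_injective he)]
    · exact fun hx => ⟨_, ⟨x, hx, rfl⟩, rfl⟩
  let j : (κ → ℝ) → V := fun y => if hy : y ∈ K then (h.symm ⟨y, hy⟩ : V) else 0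
  have hjK : ∀ y : K, j y = (h.symm y : V) := fun y => dif_pos y.2
  have hjc : ContinuousOn j K := by
    rw [continuousOn_iff_continuous_domRestrict]
    exact (continuous_subtype_val.comp h.symm.continuous).congr fun y => (hjK y).symm
  have hjh : ∀ x : X, j (h x) = x := fun x => by rw [hjK, h.symm_apply_apply]
  have hDK : ∀ A, ∀ y ∈ D A, ∃ x : X, (x : V) ∈ A ∧ ((h x : K) : κ → ℝ) = y := by
    rintro A _ ⟨_, ⟨x, hx, rfl⟩, rfl⟩
    exact ⟨x, hx, rfl⟩
  have hDsub : D A ∩ D B ⊆ K := by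
    rintro y ⟨hy, -⟩
    obtain ⟨x, -, rfl⟩ := hDK _ _ hy
    exact (h x).2
  have hjinj : InjOn j (D A ∩ D B) := by
    rintro y ⟨hy, -⟩ y' ⟨hy', -⟩ he
    obtain ⟨x, -, rfl⟩ := hDK _ _ hy
    obtain ⟨x', -, rfl⟩ := hDK _ _ hy'
    rw [hjh, hjh] at he
    rw [Subtype.ext he]
  have hjim : j '' (D A ∩ D B) ⊆ A ∩ B := by
    rintro _ ⟨y, ⟨hyA, hyB⟩, rfl⟩
    obtain ⟨x, hx, rfl⟩ := hDK _ _ hyA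
    rw [hjh]
    exact ⟨hx, memD.1 hyB⟩
  let y₀ : κ → ℝ := h ⟨v, hvX⟩
  obtain ⟨ε, hε, hball⟩ := Metric.isOpen_iff.1 (hD hR).isOpen_compl y₀
    (show y₀ ∉ D R from fun hy => hvR (memD.1 hy))
  have hnear : ∀ {B}, IsClosed B → v ∈ closure (X \ (B ∪ R)) →
      ∃ p ∈ ball y₀ ε ∩ interior K, p ∉ D B := by
    intro B hB hv
    have hcont : Continuous fun x : X => ((h x : K) : κ → ℝ) :=
      continuous_subtype_val.comp h.continuous
    have hUo : IsOpen ((fun x : X => ((h x : K) : κ → ℝ)) ⁻¹' ball y₀ ε) :=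
      isOpen_ball.preimage hcont
    obtain ⟨W, hW, hWU⟩ := isOpen_induced_iff.1 hUo
    have hvW : v ∈ W := by
      have : (⟨v, hvX⟩ : X) ∈ Subtype.val ⁻¹' W := by
        rw [hWU]; exact mem_ball_self hε
      exact this
    obtain ⟨x, hxW, hxX, hxB⟩ := mem_closure_iff.1 hv W hW hvW
    have hxball : ((h ⟨x, hxX⟩ : K) : κ → ℝ) ∈ ball y₀ ε := by
      have : (⟨x, hxX⟩ : X) ∈ Subtype.val ⁻¹' W := hxW
      rwa [hWU] at this
    have hxD : ((h ⟨x, hxX⟩ : K) : κ → ℝ) ∉ D B := fun hx => hxB (Or.inl (memD.1 hx))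
    have hcl : ((h ⟨x, hxX⟩ : K) : κ → ℝ) ∈ closure (interior K) := by
      rw [hKc.closure_interior_eq_closure_of_nonempty_interior hKi]
      exact subset_closure (h _).2
    obtain ⟨p, ⟨hp₁, hp₂⟩, hp₃⟩ := mem_closure_iff.1 hcl (ball y₀ ε \ D B)
      (isOpen_ball.sdiff (hD hB)) ⟨hxball, hxD⟩
    exact ⟨p, ⟨hp₁, hp₃⟩, hp₂⟩
  obtain ⟨p, hpO, hpB⟩ := hnear hB hvA
  obtain ⟨q, hqO, hqA⟩ := hnear hA hvB
  refine not_separated_of_dimH_lt (O := ball y₀ ε ∩ interior K) (A := D A) (B := D B) (j := j)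
    (isOpen_ball.inter isOpen_interior) ((convex_ball _ _).inter hKc.interior) (hD hA) (hD hB)
    ?_ (hjc.mono hDsub) hjinj (fun _ => ?_) ⟨hpO, hpB⟩ ⟨hqO, hqA⟩
  · rintro y ⟨hy, hyK⟩
    have hx := h.apply_symm_apply ⟨y, interior_subset hyK⟩
    set x := h.symm ⟨y, interior_subset hyK⟩
    have hxy : ((h x : K) : κ → ℝ) = y := congrArg Subtype.val hx
    rw [← hxy] at hy ⊢
    rcases hcov x.2 with (hxA | hxB) | hxR
    · exact Or.inl (memD.2 hxA)
    · exact Or.inr (memD.2 hxB)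
    · exact absurd (memD.2 hxR) (hball hy)
  · exact lt_of_le_of_lt (by gcongr) hdim

open Module in
/-- The convex hull of `n + 1` points has Hausdorff dimension at most `n`. -/
theorem dimH_convexHull_finset_le {E : Type*} [NormedAddCommGroup E] [NormedSpace ℝ E]
    [FiniteDimensional ℝ E] {S : Finset E} {n : ℕ} (hS : S.card = n + 1) :
    dimH (convexHull ℝ (S : Set E)) ≤ n := by
  classical
  have hne : (convexHull ℝ (S : Set E)).Nonempty :=
    (Finset.coe_nonempty.2 (Finset.card_pos.1 (by omega))).convexHull
  rw [Real.Convex.dimH_eq_finrank_vectorSpan (convex_convexHull ℝ _) hne, ← direction_affineSpan,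
    affineSpan_convexHull, direction_affineSpan]
  have := finrank_vectorSpan_image_finset_le ℝ (id : E → E) S hS
  rw [Finset.image_id] at this
  exact_mod_cast this

/-- A convex combination of affinely independent points with positive weights does not lie in the
convex hull of a proper subset of these points. -/
theorem AffineIndependent.notMem_convexHull_of_ssubset {E : Type*} [AddCommGroup E] [Module ℝ E]
    {F H : Finset E} (hF : AffineIndependent ℝ (fun p : F => (p : E))) (hH : H ⊂ F) {w : E → ℝ}
    (hw : ∀ a ∈ F, 0 < w a) (hw1 : ∑ a ∈ F, w a = 1) :
    ∑ a ∈ F, w a • a ∉ convexHull ℝ (H : Set E) := by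
  classical
  intro hx
  obtain ⟨u, -, hu1, hux⟩ := Finset.mem_convexHull'.1 hx
  obtain ⟨a, haF, haH⟩ := Finset.exists_of_ssubset hH
  have key := affineIndependent_iff.1 hF Finset.univ
    (fun y => w y - if (y : E) ∈ H then u y else 0) ?_ ?_ ⟨a, haF⟩ (Finset.mem_univ _)
  · simp only [haH, if_false, sub_zero] at key
    exact (hw a haF).ne' key
  · rw [Finset.univ_eq_attach,
      Finset.sum_attach F (fun y => w y - if y ∈ H then u y else 0), Finset.sum_sub_distrib,
      Finset.sum_ite_mem,
      Finset.inter_eq_right.2 hH.1, hw1, hu1, sub_self]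
  · rw [Finset.univ_eq_attach,
      Finset.sum_attach F (fun y => (w y - if y ∈ H then u y else 0) • y)]
    simp only [sub_smul, ite_smul, zero_smul]
    rw [Finset.sum_sub_distrib, Finset.sum_ite_mem, Finset.inter_eq_right.2 hH.1, hux, sub_self]

open Filter Topology in
/-- A vertex of a cell `F` is a limit of points of `F` which lie in no other maximal cell. -/
theorem mem_closure_convexHull_diff {E : Type*} [NormedAddCommGroup E] [NormedSpace ℝ E]
    {T : Finset (Finset E)} (hglue : ∀ F ∈ T, ∀ G ∈ T,
      convexHull ℝ (F : Set E) ∩ convexHull ℝ (G : Set E) = convexHull ℝ ((F : Set E) ∩ (G : Set E)))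
    {F : Finset E} (hF : AffineIndependent ℝ (fun p : F => (p : E))) (hFT : F ∈ T) {v : E}
    (hv : v ∈ F) :
    v ∈ closure {x ∈ convexHull ℝ (F : Set E) |
      ∀ G ∈ T, ¬ F ⊆ G → x ∉ convexHull ℝ (G : Set E)} := by
  classical
  let w : ℝ → E → ℝ := fun t a => t / F.card + if a = v then 1 - t else 0
  have hc : (0 : ℝ) < F.card := by exact_mod_cast Finset.card_pos.2 ⟨v, hv⟩
  have hw1 : ∀ t, ∑ a ∈ F, w t a = 1 := by
    intro t
    simp only [w, Finset.sum_add_distrib, Finset.sum_const, nsmul_eq_mul, Finset.sum_ite_eq', hv,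
      if_true]
    field_simp
    ring
  have hwpos : ∀ t, 0 < t → t < 1 → ∀ a ∈ F, 0 < w t a := by
    intro t ht ht1 a _
    have : 0 < t / F.card := div_pos ht hc
    simp only [w]
    split_ifs <;> linarith
  have hlim : Tendsto (fun t => ∑ a ∈ F, w t a • a) (𝓝[>] 0) (𝓝 v) := by
    have hcont : Continuous fun t => ∑ a ∈ F, w t a • a := by
      refine continuous_finsetSum _ fun a _ => ?_
      simp only [w]
      split_ifs <;> fun_prop
    have h0 : ∑ a ∈ F, w 0 a • a = v := by simp [w, hv]
    have := (hcont.tendsto 0).mono_left (nhdsWithin_le_nhds (s := Set.Ioi 0))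
    rwa [h0] at this
  refine mem_closure_of_tendsto hlim ?_
  filter_upwards [Ioo_mem_nhdsGT (zero_lt_one' ℝ)] with t ht
  have hmem : ∑ a ∈ F, w t a • a ∈ convexHull ℝ (F : Set E) :=
    Finset.mem_convexHull'.2 ⟨w t, fun a ha => (hwpos t ht.1 ht.2 a ha).le, hw1 t, rfl⟩
  refine ⟨hmem, fun G hG hFG hxG => ?_⟩
  have hx : ∑ a ∈ F, w t a • a ∈ convexHull ℝ ((F ∩ G : Finset E) : Set E) := by
    rw [Finset.coe_inter, ← hglue F hFT G hG]
    exact ⟨hmem, hxG⟩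
  exact hF.notMem_convexHull_of_ssubset
    ⟨Finset.inter_subset_left, fun h => hFG (Finset.subset_inter_iff.1 h).2⟩
    (hwpos t ht.1 ht.2) (hw1 t) hx

open Set in
/-- A simplex with vertex `v` contains an embedded cube with one coordinate for each of its other
vertices. -/
theorem AffineIndependent.exists_cube_embedding {E : Type*} [NormedAddCommGroup E]
    [NormedSpace ℝ E] [DecidableEq E] {F : Finset E}
    (hF : AffineIndependent ℝ (fun p : F => (p : E))) {v : E} (hv : v ∈ F) :
    ∃ j : (F.erase v → ℝ) → E, Continuous j ∧ Function.Injective j ∧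
      MapsTo j (Icc (-1) 1) (convexHull ℝ (F : Set E)) := by
  let N : ℝ := 2 * F.card
  have hc : (0 : ℝ) < F.card := by exact_mod_cast Finset.card_pos.2 ⟨v, hv⟩
  have hN : 0 < N := by positivity
  let c : (F.erase v → ℝ) → F.erase v → ℝ := fun x a => (x a + 1) / N
  refine ⟨fun x => v + ∑ a, c x a • ((a : E) - v), ?_, ?_, ?_⟩
  · simp only [c]
    fun_prop
  · intro x y hxy
    have hli := (affineIndependent_iff_linearIndependent_vsub ℝ _ (⟨v, hv⟩ : F)).1 hF
    let e : F.erase v → {p : F // p ≠ ⟨v, hv⟩} := fun a =>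
      ⟨⟨a, Finset.mem_of_mem_erase a.2⟩, fun h =>
        Finset.ne_of_mem_erase a.2 (congrArg Subtype.val h)⟩
    have he : Function.Injective e := fun a b h =>
      Subtype.ext (congrArg (fun p => ((p.1 : F) : E)) h)
    have hli' : LinearIndependent ℝ fun a : F.erase v => (a : E) - v := hli.comp e he
    have hsum : ∑ a, c x a • ((a : E) - v) = ∑ a, c y a • ((a : E) - v) := add_left_cancel hxy
    have h0 : ∑ a, (c x a - c y a) • ((a : E) - v) = 0 := by
      simp only [sub_smul (c x _)]
      rw [Finset.sum_sub_distrib, hsum, sub_self]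
    funext a
    have := Fintype.linearIndependent_iff.1 hli' (fun a => c x a - c y a) h0 a
    have h2 : (x a + 1) / N = (y a + 1) / N := sub_eq_zero.1 this
    rw [div_left_inj' hN.ne'] at h2
    linarith
  · intro x hx
    have hcx : ∀ a, 0 ≤ c x a ∧ c x a ≤ 1 / F.card := by
      intro a
      have h1 : -1 ≤ x a := hx.1 a
      have h2 : x a ≤ 1 := hx.2 a
      refine ⟨div_nonneg (by linarith) hN.le, ?_⟩
      rw [div_le_div_iff₀ hN hc]
      simp only [N]
      nlinarith
    have hs : ∑ a, c x a ≤ 1 := by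
      calc ∑ a, c x a ≤ ∑ _a : F.erase v, (1 : ℝ) / F.card := Finset.sum_le_sum fun a _ => (hcx a).2
        _ = (F.erase v).card * (1 / F.card) := by simp
        _ ≤ F.card * (1 / F.card) := by
            gcongr
            exact Finset.erase_subset _ _
        _ = 1 := by field_simp
    have heq : v + ∑ a, c x a • ((a : E) - v) = (1 - ∑ a, c x a) • v + ∑ a, c x a • (a : E) := by
      simp only [smul_sub, Finset.sum_sub_distrib, sub_smul, one_smul, ← Finset.sum_smul]
      abel
    have hconv := convex_convexHull ℝ (F : Set E)
    have hmem := hconv.sum_mem (t := Finset.univ) (w := fun o : Option (F.erase v) =>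
      o.elim (1 - ∑ a, c x a) (c x)) (z := fun o => o.elim v (fun a => (a : E))) ?_ ?_ ?_
    · beta_reduce
      rw [Fintype.sum_option] at hmem
      rw [heq]
      exact hmem
    · rintro (_ | a) -
      · exact sub_nonneg.2 hs
      · exact (hcx a).1
    · rw [Fintype.sum_option]
      exact sub_add_cancel _ _
    · rintro (_ | a) -
      · exact subset_convexHull ℝ _ hv
      · exact subset_convexHull ℝ _ (Finset.mem_of_mem_erase a.2)

/-- A simplex contained in a space homeomorphic to a subset of `ℝ^κ` has at most `card κ + 1`
vertices. -/
theorem AffineIndependent.card_le_of_homeomorph {E κ : Type*} [NormedAddCommGroup E]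
    [NormedSpace ℝ E] [Fintype κ] {X : Set E} {K : Set (κ → ℝ)} (h : X ≃ₜ K) {F : Finset E}
    (hF : AffineIndependent ℝ (fun p : F => (p : E))) {v : E} (hv : v ∈ F)
    (hFX : convexHull ℝ (F : Set E) ⊆ X) : F.card ≤ Fintype.card κ + 1 := by
  classical
  obtain ⟨j, hjc, hji, hjF⟩ := hF.exists_cube_embedding hv
  let g : (F.erase v → ℝ) → κ → ℝ := fun x => if hx : j x ∈ X then h ⟨j x, hx⟩ else 0
  have hg : ∀ x : Set.Icc (-1 : F.erase v → ℝ) 1, g x = h ⟨j x, hFX (hjF x.2)⟩ :=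
    fun x => dif_pos (hFX (hjF x.2))
  have hcont : ContinuousOn g (Set.Icc (-1) 1) := by
    rw [continuousOn_iff_continuous_domRestrict]
    exact (continuous_subtype_val.comp (h.continuous.comp
      ((hjc.comp continuous_subtype_val).subtype_mk fun x => hFX (hjF x.2)))).congr
        fun x => (hg x).symm
  have hinj : Set.InjOn g (Set.Icc (-1) 1) := by
    intro x hx y hy hxy
    have h1 := hg ⟨x, hx⟩
    have h2 := hg ⟨y, hy⟩
    have h3 := h.injective (Subtype.val_injective (h1.symm.trans (hxy.trans h2)))
    exact hji (congrArg Subtype.val h3)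
  have := card_le_finrank_of_cube_embedding hcont hinj
  rw [Fintype.card_coe, Finset.card_erase_of_mem hv, Module.finrank_fintype_fun_eq_card] at this
  omega

/-- Every face is contained in a maximal cell. -/
theorem exists_maxCell_superset {E : Type*} {T : Finset (Finset E)} {F : Finset E} (hF : F ∈ T) :
    ∃ G, MaxCell T G ∧ F ⊆ G := by
  obtain ⟨G, hFG, hG⟩ := T.exists_le_maximal hF
  exact ⟨G, ⟨hG.1, fun H hH hGH => (hG.2 hH hGH).antisymm hGH⟩, hFG⟩

/-- In a triangulated convex body, the maximal cells at a vertex cannot be split into two nonempty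
classes such that cells of different classes share no facet. -/
theorem not_separated_star {E κ : Type*} [NormedAddCommGroup E] [NormedSpace ℝ E]
    [FiniteDimensional ℝ E] [DecidableEq E] [Fintype κ] {T : Finset (Finset E)}
    (hind : ∀ F ∈ T, AffineIndependent ℝ (fun p : F => (p : E)))
    (hdown : ∀ F ∈ T, ∀ G, G ⊆ F → G ∈ T)
    (hglue : ∀ F ∈ T, ∀ G ∈ T, convexHull ℝ (F : Set E) ∩ convexHull ℝ (G : Set E) =
      convexHull ℝ ((F : Set E) ∩ (G : Set E)))
    {K : Set (κ → ℝ)} (hK : IsClosed K) (hKc : Convex ℝ K) (hKi : (interior K).Nonempty)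
    (h : (⋃ F ∈ T, convexHull ℝ (F : Set E) : Set E) ≃ₜ K) {v : E} {P : Finset E → Prop}
    (hP : ∀ F G, MaxCell T F → MaxCell T G → v ∈ F → v ∈ G → P F → ¬ P G →
      (F ∩ G).card + 2 ≤ F.card)
    {F₀ G₀ : Finset E} (hF₀ : MaxCell T F₀) (hG₀ : MaxCell T G₀) (hvF₀ : v ∈ F₀) (hvG₀ : v ∈ G₀)
    (hPF : P F₀) (hPG : ¬ P G₀) : False := by
  classical
  let C : (Finset E → Prop) → Set E := fun Q =>
    ⋃ F ∈ T.filter (fun F => MaxCell T F ∧ Q F), convexHull ℝ (F : Set E)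
  have hC : ∀ Q, IsClosed (C Q) := fun Q =>
    (Finset.finite_toSet _).isClosed_biUnion fun F _ => F.finite_toSet.isClosed_convexHull ℝ
  have memC : ∀ {Q : Finset E → Prop} {x : E}, x ∈ C Q ↔ ∃ F, MaxCell T F ∧ Q F ∧ x ∈ convexHull ℝ (F : Set E) := by
    intro Q x
    simp only [C, Set.mem_iUnion, Finset.mem_filter, exists_prop]
    exact ⟨fun ⟨F, ⟨_, h1, h2⟩, h3⟩ => ⟨F, h1, h2, h3⟩, fun ⟨F, h1, h2, h3⟩ =>
      ⟨F, ⟨h1.1, h1, h2⟩, h3⟩⟩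
  have hsubX : ∀ F ∈ T, convexHull ℝ (F : Set E) ⊆ ⋃ F ∈ T, convexHull ℝ (F : Set E) :=
    fun F hF => Set.subset_biUnion_of_mem (u := fun F : Finset E => convexHull ℝ (F : Set E)) hF
  have hcard : ∀ F, MaxCell T F → v ∈ F → F.card ≤ Fintype.card κ + 1 := fun F hF hv =>
    (hind F hF.1).card_le_of_homeomorph h hv (hsubX F hF.1)
  have hinter : ∀ {F G : Finset E}, v ∈ F → v ∈ G → 0 < (F ∩ G).card := fun hF hG =>
    Finset.card_pos.2 ⟨v, Finset.mem_inter.2 ⟨hF, hG⟩⟩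
  have hclosure : ∀ {F : Finset E} {Q : Finset E → Prop}, MaxCell T F → v ∈ F → ¬ Q F →
      v ∈ closure ((⋃ F ∈ T, convexHull ℝ (F : Set E)) \
        (C (fun F => v ∈ F ∧ Q F) ∪ C (fun F => v ∉ F))) := by
    intro F Q hF hv hQ
    refine closure_mono ?_ (mem_closure_convexHull_diff hglue (hind F hF.1) hF.1 hv)
    rintro x ⟨hxF, hx⟩
    refine ⟨hsubX F hF.1 hxF, ?_⟩
    rintro (hxC | hxC)
    · obtain ⟨G, hG, ⟨-, hQG⟩, hxG⟩ := memC.1 hxC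
      refine hx G hG.1 (fun hFG => hQ ?_) hxG
      rwa [← hF.2 G hG.1 hFG]
    · obtain ⟨G, hG, hvG, hxG⟩ := memC.1 hxC
      exact hx G hG.1 (fun hFG => hvG (hFG hv)) hxG
  refine not_locally_separated_of_dimH_lt hK hKc hKi h (hC fun F => v ∈ F ∧ P F)
    (hC fun F => v ∈ F ∧ ¬ P F) (hC fun F => v ∉ F) ?_ ?_ (v := v)
    (hsubX F₀ hF₀.1 (subset_convexHull ℝ _ hvF₀)) ?_ (hclosure hF₀ hvF₀ (not_not.2 hPF))
    (hclosure hG₀ hvG₀ hPG)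
  · intro x hx
    simp only [Set.mem_iUnion, exists_prop] at hx
    obtain ⟨F, hF, hxF⟩ := hx
    obtain ⟨G, hG, hFG⟩ := exists_maxCell_superset hF
    have hxG := convexHull_mono (𝕜 := ℝ) (Finset.coe_subset.2 hFG) hxF
    by_cases hv : v ∈ G
    · by_cases hQ : P G
      · exact Or.inl (Or.inl (memC.2 ⟨G, hG, ⟨hv, hQ⟩, hxG⟩))
      · exact Or.inl (Or.inr (memC.2 ⟨G, hG, ⟨hv, hQ⟩, hxG⟩))
    · exact Or.inr (memC.2 ⟨G, hG, hv, hxG⟩)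
  · obtain ⟨k, hk⟩ : ∃ k, Fintype.card κ = k + 2 := by
      have h1 := hinter hvF₀ hvG₀
      have h2 := hP F₀ G₀ hF₀ hG₀ hvF₀ hvG₀ hPF hPG
      have h3 := hcard F₀ hF₀ hvF₀
      exact ⟨Fintype.card κ - 2, by omega⟩
    have hle : dimH (C (fun F => v ∈ F ∧ P F) ∩ C (fun F => v ∈ F ∧ ¬ P F)) ≤ k := by
      have hsub : C (fun F => v ∈ F ∧ P F) ∩ C (fun F => v ∈ F ∧ ¬ P F) ⊆
          ⋃ S ∈ T.filter (fun S => 0 < S.card ∧ S.card ≤ k + 1), convexHull ℝ (S : Set E) := by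
        rintro x ⟨hxA, hxB⟩
        obtain ⟨F, hF, ⟨hvF, hPF⟩, hxF⟩ := memC.1 hxA
        obtain ⟨G, hG, ⟨hvG, hPG⟩, hxG⟩ := memC.1 hxB
        have h2 := hP F G hF hG hvF hvG hPF hPG
        have h3 := hcard F hF hvF
        refine Set.mem_biUnion (x := F ∩ G) (Finset.mem_filter.2
          ⟨hdown F hF.1 _ Finset.inter_subset_left, hinter hvF hvG, by omega⟩) ?_
        rw [Finset.coe_inter, ← hglue F hF.1 G hG.1]
        exact ⟨hxF, hxG⟩
      refine (dimH_mono hsub).trans ?_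
      refine (dimH_bUnion (Finset.countable_toSet (T.filter _)) _).trans_le
        (iSup₂_le fun S hS => ?_)
      obtain ⟨-, hS0, hSk⟩ := Finset.mem_filter.1 hS
      refine (dimH_convexHull_finset_le (n := S.card - 1) (by omega)).trans ?_
      exact_mod_cast (by omega : S.card - 1 ≤ k)
    rw [hk]
    refine lt_of_le_of_lt (add_le_add_left hle 1) ?_
    exact_mod_cast Nat.lt_succ_self (k + 1)
  · intro hv
    obtain ⟨G, hG, hvG, hx⟩ := memC.1 hv
    have hvs : v ∈ convexHull ℝ (({v} : Finset E) : Set E) ∩ convexHull ℝ (G : Set E) :=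
      ⟨subset_convexHull ℝ _ (by simp), hx⟩
    rw [hglue {v} (hdown F₀ hF₀.1 _ (Finset.singleton_subset_iff.2 hvF₀)) G hG.1,
      Finset.coe_singleton, Set.singleton_inter_eq_empty.2 (by simpa using hvG),
      convexHull_empty] at hvs
    exact hvs

/-- **Simplicial balls with tree dual graphs are flag.** Let `T` be a (geometric)
simplicial complex whose underlying space is homeomorphic to a closed ball and whose dual
graph (maximal simplices, adjacent when they share a common facet, i.e. a codimension-one
face) is a tree.  Then every minimal non-face of `T` has exactly two elements. -/
theorem ball_with_tree_dual_graph_is_flag {n : ℕ} (T : Finset (Finset (Fin n → ℝ)))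
    (hind : ∀ F ∈ T, AffineIndependent ℝ (fun p : F => (p : Fin n → ℝ)))
    (hdown : ∀ F ∈ T, ∀ G, G ⊆ F → G ∈ T)
    (hglue : ∀ F ∈ T, ∀ G ∈ T,
      convexHull ℝ (F : Set (Fin n → ℝ)) ∩ convexHull ℝ (G : Set (Fin n → ℝ)) =
        convexHull ℝ ((F : Set (Fin n → ℝ)) ∩ (G : Set (Fin n → ℝ))))
    (hball : ∃ m : ℕ, Nonempty
      (↥(⋃ F ∈ T, convexHull ℝ (F : Set (Fin n → ℝ))) ≃ₜ
        ↥(Metric.closedBall (0 : EuclideanSpace ℝ (Fin m)) 1)))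
    (htree : (SimpleGraph.fromRel
        (fun (F G : {F : Finset (Fin n → ℝ) // MaxCell T F}) =>
          (F.1 ∩ G.1).card + 1 = F.1.card ∧ (F.1 ∩ G.1).card + 1 = G.1.card)).IsTree) :
    IsFlag T := by
  classical
  obtain ⟨m, ⟨h⟩⟩ := hball
  let e := EuclideanSpace.equiv (Fin m) ℝ
  let K : Set (Fin m → ℝ) := e '' Metric.closedBall 0 1
  have hK : IsClosed K :=
    e.toHomeomorph.isClosedMap _ Metric.isClosed_closedBall
  have hKc : Convex ℝ K := (convex_closedBall 0 1).linear_image e.toLinearEquiv.toLinearMap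
  have hKi : (interior K).Nonempty := by
    have h0 : e 0 ∈ e '' interior (Metric.closedBall 0 1) := ⟨0, by
      rw [interior_closedBall _ one_ne_zero]
      exact Metric.mem_ball_self one_pos, rfl⟩
    exact ⟨e 0, e.toHomeomorph.image_interior _ ▸ h0⟩
  let h' := h.trans (e.toHomeomorph.image (Metric.closedBall 0 1))
  set D := SimpleGraph.fromRel
    (fun (F G : {F : Finset (Fin n → ℝ) // MaxCell T F}) =>
      (F.1 ∩ G.1).card + 1 = F.1.card ∧ (F.1 ∩ G.1).card + 1 = G.1.card) with hD
  have hadj : ∀ {F G : {F : Finset (Fin n → ℝ) // MaxCell T F}}, D.Adj F G →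
      F.1.card = G.1.card := by
    intro F G hFG
    rw [hD, SimpleGraph.fromRel_adj] at hFG
    rcases hFG.2 with h | h <;> omega
  have hcard : ∀ F G : {F : Finset (Fin n → ℝ) // MaxCell T F}, F.1.card = G.1.card := by
    intro F G
    obtain ⟨p⟩ := htree.connected.preconnected F G
    induction p with
    | nil => rfl
    | cons h _ ih => exact (hadj h).trans ih
  have hstar : ∀ v : Fin n → ℝ,
      (D.induce {F : {F : Finset (Fin n → ℝ) // MaxCell T F} | v ∈ F.1}).Preconnected := by
    rintro v ⟨F₀, hvF₀⟩ ⟨G₀, hvG₀⟩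
    by_contra hr
    let P : Finset (Fin n → ℝ) → Prop := fun F => ∃ (hF : MaxCell T F) (hv : v ∈ F),
      (D.induce {F : {F : Finset (Fin n → ℝ) // MaxCell T F} | v ∈ F.1}).Reachable
        ⟨F₀, hvF₀⟩ ⟨⟨F, hF⟩, hv⟩
    refine not_separated_star hind hdown hglue hK hKc hKi h' (P := P) ?_ F₀.2 G₀.2 hvF₀ hvG₀
      ⟨F₀.2, hvF₀, .rfl⟩ fun ⟨_, _, hr'⟩ => hr hr'
    rintro F G hF hG hvF hvG ⟨_, _, hFr⟩ hGr
    have hne : F ≠ G := by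
      rintro rfl
      exact hGr ⟨hF, hvF, hFr⟩
    have hc : F.card = G.card := hcard ⟨F, hF⟩ ⟨G, hG⟩
    have hlt : (F ∩ G).card < F.card := Finset.card_lt_card
      ⟨Finset.inter_subset_left, fun hs =>
        hne (hF.2 G hG.1 (Finset.subset_inter_iff.1 hs).2).symm⟩
    by_contra hcon
    have hFG : D.Adj ⟨F, hF⟩ ⟨G, hG⟩ := by
      rw [hD, SimpleGraph.fromRel_adj]
      exact ⟨fun h => hne (congrArg Subtype.val h),
        Or.inl ⟨by dsimp only; omega, by dsimp only; omega⟩⟩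
    exact hGr ⟨hG, hvG, hFr.trans (SimpleGraph.Adj.reachable hFG)⟩
  rintro N ⟨hN1, hNT, hNM⟩
  obtain ⟨F₁⟩ := htree.connected.nonempty
  have hN0 : N.Nonempty := by
    rw [Finset.nonempty_iff_ne_empty]
    rintro rfl
    exact hNT (hdown F₁.1 F₁.2.1 _ (Finset.empty_subset _))
  have hN1' : N.card ≠ 1 := by
    intro h1
    obtain ⟨x, rfl⟩ := Finset.card_eq_one.1 h1
    exact hNT (hN1 x (Finset.mem_singleton_self x))
  have hpos := Finset.card_pos.2 hN0
  by_contra hN2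
  obtain ⟨a, b, c, ha, hb, hc, hab, hac, hbc⟩ := Finset.two_lt_card_iff.1 (by omega : 2 < N.card)
  have hface : ∀ a ∈ N, ∃ F : {F : Finset (Fin n → ℝ) // MaxCell T F}, N.erase a ⊆ F.1 := by
    intro a ha
    obtain ⟨F, hF, hs⟩ := exists_maxCell_superset (hNM _ (Finset.erase_ssubset ha))
    exact ⟨⟨F, hF⟩, hs⟩
  obtain ⟨Fa, hFa⟩ := hface a ha
  obtain ⟨Fb, hFb⟩ := hface b hb
  obtain ⟨Fc, hFc⟩ := hface c hc
  obtain ⟨M, hM⟩ := htree.exists_median Fa Fb Fc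
  refine hNT (hdown M.1 M.2.1 N fun v hv => hM _ (hstar v) ?_)
  have h1 : v ≠ a → v ∈ Fa.1 := fun h => hFa (Finset.mem_erase.2 ⟨h, hv⟩)
  have h2 : v ≠ b → v ∈ Fb.1 := fun h => hFb (Finset.mem_erase.2 ⟨h, hv⟩)
  have h3 : v ≠ c → v ∈ Fc.1 := fun h => hFc (Finset.mem_erase.2 ⟨h, hv⟩)
  by_cases hva : v = a
  · subst hva
    exact Or.inr (Or.inl ⟨h2 hab, h3 hac⟩)
  · by_cases hvb : v = b
    · subst hvb
      exact Or.inr (Or.inr ⟨h1 hva, h3 hbc⟩)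
    · exact Or.inl ⟨h1 hva, h2 hvb⟩
end

section
/- Let π: Δ^d → Δ^r and π': Δ^{d'} → Δ^r be lattice-preserving affine projections between unimodular simplices (each vertex of the source mapping to a vertex of Δ^r). Then the fiber product Δ^d ×_{Δ^r} Δ^{d'} = {(p, p') ∈ Δ^d × Δ^{d'} : π(p) = π'(p')} is a lattice polytope, i.e. all of its vertices are lattice points. -/
section Coupling

variable {ι κ ρ : Type*} [Fintype ι] [Fintype κ] [DecidableEq ρ]

/-- Two nonnegative vectors with the same pushforward have a coupling supported on the
compatible pairs of indices. -/
theorem exists_coupling_of_pushforward_eq (f : ι → ρ) (g : κ → ρ) (x : ι → ℝ) (y : κ → ℝ)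
    (hx : ∀ i, 0 ≤ x i) (hy : ∀ j, 0 ≤ y j)
    (h : ∀ ν, (∑ i, if f i = ν then x i else 0) = ∑ j, if g j = ν then y j else 0) :
    ∃ w : ι → κ → ℝ, (∀ i j, 0 ≤ w i j) ∧ (∀ i j, f i ≠ g j → w i j = 0) ∧
      (∀ i, ∑ j, w i j = x i) ∧ ∀ j, ∑ i, w i j = y j := by
  set s : ρ → ℝ := fun ν => ∑ i, if f i = ν then x i else 0 with hs
  have hx_nonneg : ∀ ν i, 0 ≤ if f i = ν then x i else 0 := fun ν i => by
    split_ifs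
    exacts [hx i, le_rfl]
  have hy_nonneg : ∀ ν j, 0 ≤ if g j = ν then y j else 0 := fun ν j => by
    split_ifs
    exacts [hy j, le_rfl]
  have hs_nonneg : ∀ ν, 0 ≤ s ν := fun ν => Finset.sum_nonneg fun i _ => hx_nonneg ν i
  have hxs : ∀ i, x i ≤ s (f i) := fun i => by
    simpa using Finset.single_le_sum (fun k _ => hx_nonneg (f i) k) (Finset.mem_univ i)
  have hys : ∀ j, y j ≤ s (g j) := fun j => by
    have hj := Finset.single_le_sum (fun k _ => hy_nonneg (g j) k) (Finset.mem_univ j)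
    rw [← h] at hj
    simpa using hj
  refine ⟨fun i j => if g j = f i then x i * y j / s (f i) else 0, ?_, ?_, ?_, ?_⟩
  · intro i j
    dsimp only
    split_ifs
    exacts [div_nonneg (mul_nonneg (hx i) (hy j)) (hs_nonneg _), le_rfl]
  · intro i j hij
    exact if_neg (Ne.symm hij)
  · intro i
    have hsum : (∑ j, if g j = f i then x i * y j / s (f i) else 0) =
        x i / s (f i) * s (f i) := by
      rw [show s (f i) = _ from h (f i), Finset.mul_sum]
      refine Finset.sum_congr rfl fun j _ => ?_
      split_ifs <;> ring
    rw [hsum]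
    exact div_mul_cancel_of_imp fun h0 => le_antisymm (h0 ▸ hxs i) (hx i)
  · intro j
    have hsum : (∑ i, if g j = f i then x i * y j / s (f i) else 0) =
        y j / s (g j) * s (g j) := by
      conv_rhs => rw [hs]
      rw [Finset.mul_sum]
      refine Finset.sum_congr rfl fun i _ => ?_
      by_cases hij : f i = g j
      · simp only [hij, if_true, hs]
        ring
      · simp [hij, Ne.symm hij]
    rw [hsum]
    exact div_mul_cancel_of_imp fun h0 => le_antisymm (h0 ▸ hys j) (hy j)

end Coupling

/-- An affine map sending the vertices of a standard simplex to coordinate vectors acts on the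
simplex as the pushforward of weights along the induced map of vertices. -/
theorem AffineMap.apply_of_mem_stdSimplex {ι ρ : Type*} [Fintype ι] [DecidableEq ι]
    [DecidableEq ρ] (φ : (ι → ℝ) →ᵃ[ℝ] (ρ → ℝ)) (f : ι → ρ)
    (hφ : ∀ i, φ (Pi.single i 1) = Pi.single (f i) 1) {x : ι → ℝ} (hx : x ∈ stdSimplex ℝ ι)
    (ν : ρ) : φ x ν = ∑ i, if f i = ν then x i else 0 := by
  have hlin : ∀ v, φ v = φ.linear v + φ 0 := fun v => congrFun φ.decomp v
  have hvertex : ∀ i, φ.linear (Pi.single i 1) = Pi.single (f i) 1 - φ 0 := fun i => by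
    rw [← hφ, hlin, add_sub_cancel_right]
  have hsum : φ.linear x = ∑ i, x i • (Pi.single (f i) 1 - φ 0) := by
    conv_lhs => rw [pi_eq_sum_univ' x, map_sum]
    exact Finset.sum_congr rfl fun i _ => by rw [map_smul, hvertex]
  rw [hlin, hsum]
  simp only [Pi.add_apply, Finset.sum_apply, Pi.smul_apply, smul_eq_mul, Pi.sub_apply, mul_sub,
    Finset.sum_sub_distrib, ← Finset.sum_mul, hx.2, one_mul, sub_add_cancel, Pi.single_apply,
    mul_ite, mul_one, mul_zero, eq_comm (a := ν)]

/-- The fiber product of two standard simplices is the convex hull of the pairs of vertices with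
the same image. -/
theorem fiberProduct_stdSimplex_eq_convexHull {ι κ ρ : Type*} [Fintype ι] [Fintype κ]
    [DecidableEq ι] [DecidableEq κ] [DecidableEq ρ]
    (φ : (ι → ℝ) →ᵃ[ℝ] (ρ → ℝ)) (ψ : (κ → ℝ) →ᵃ[ℝ] (ρ → ℝ)) (f : ι → ρ) (g : κ → ρ)
    (hφ : ∀ i, φ (Pi.single i 1) = Pi.single (f i) 1)
    (hψ : ∀ j, ψ (Pi.single j 1) = Pi.single (g j) 1) :
    {p : (ι → ℝ) × (κ → ℝ) | p.1 ∈ stdSimplex ℝ ι ∧ p.2 ∈ stdSimplex ℝ κ ∧ φ p.1 = ψ p.2} =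
      convexHull ℝ {p | ∃ i j, f i = g j ∧ p = (Pi.single i 1, Pi.single j 1)} := by
  refine Set.Subset.antisymm ?_ (convexHull_min ?_ ?_)
  · rintro ⟨x, y⟩ ⟨hx, hy, hxy⟩
    dsimp only at hx hy hxy
    obtain ⟨w, hw, hw_supp, hwx, hwy⟩ := exists_coupling_of_pushforward_eq f g x y hx.1 hy.1
      fun ν => by
        rw [← φ.apply_of_mem_stdSimplex f hφ hx, ← ψ.apply_of_mem_stdSimplex g hψ hy, hxy]
    have hsupp : ∀ q : ι × κ, q ∉ Finset.univ.filter (fun q : ι × κ => f q.1 = g q.2) →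
        w q.1 q.2 = 0 := fun q hq => hw_supp _ _ (by simpa using hq)
    have hmem := (convex_convexHull ℝ
      {p : (ι → ℝ) × (κ → ℝ) | ∃ i j, f i = g j ∧ p = (Pi.single i 1, Pi.single j 1)}).sum_mem
      (t := Finset.univ.filter fun q : ι × κ => f q.1 = g q.2) (w := fun q => w q.1 q.2)
      (z := fun q => (Pi.single q.1 1, Pi.single q.2 1)) (fun q _ => hw _ _)
      (by
        rw [Finset.sum_subset (Finset.subset_univ _) fun q _ hq => hsupp q hq,
          Fintype.sum_prod_type]
        simp only [hwx, hx.2])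
      (fun q hq => subset_convexHull ℝ _ ⟨q.1, q.2, by simpa using hq, rfl⟩)
    rw [Finset.sum_subset (Finset.subset_univ _) fun q _ hq => by rw [hsupp q hq, zero_smul]]
      at hmem
    convert hmem using 1
    ext k
    · rw [Fintype.sum_prod_type]
      simp [Prod.fst_sum, Finset.sum_apply, Pi.single_apply, hwx]
    · rw [Fintype.sum_prod_type_right]
      simp [Prod.snd_sum, Finset.sum_apply, Pi.single_apply, hwy]
  · rintro _ ⟨i, j, hij, rfl⟩
    exact ⟨single_mem_stdSimplex ℝ i, single_mem_stdSimplex ℝ j, by simp only [hφ, hψ, hij]⟩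
  · rintro p ⟨hp₁, hp₂, hp⟩ q ⟨hq₁, hq₂, hq⟩ a b ha hb hab
    refine ⟨convex_stdSimplex ℝ ι hp₁ hq₁ ha hb hab, convex_stdSimplex ℝ κ hp₂ hq₂ ha hb hab, ?_⟩
    simp only [Prod.fst_add, Prod.snd_add, Prod.smul_fst, Prod.smul_snd,
      Convex.combo_affine_apply hab, hp, hq]

/-- **Fiber products of unimodular simplices are lattice polytopes.** Let
`π : Δ^d → Δ^r` and `π' : Δ^{d'} → Δ^r` be affine projections between standard simplices
mapping each vertex of the source to a vertex of `Δ^r` (in particular lattice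
preserving).  Then every vertex (extreme point) of the fiber product
`Δ^d ×_{Δ^r} Δ^{d'} = {(p, p') : π p = π' p'}` is a lattice point. -/
theorem fiber_product_of_simplices_is_lattice {d d' r : ℕ}
    (π : (Fin (d + 1) → ℝ) →ᵃ[ℝ] (Fin (r + 1) → ℝ))
    (π' : (Fin (d' + 1) → ℝ) →ᵃ[ℝ] (Fin (r + 1) → ℝ))
    (hπ : ∀ i : Fin (d + 1), ∃ ν : Fin (r + 1),
      π (Pi.single i 1) = Pi.single ν 1)
    (hπ' : ∀ j : Fin (d' + 1), ∃ ν : Fin (r + 1),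
      π' (Pi.single j 1) = Pi.single ν 1) :
    ∀ x ∈ Set.extremePoints ℝ
        {p : (Fin (d + 1) → ℝ) × (Fin (d' + 1) → ℝ) |
          p.1 ∈ stdSimplex ℝ (Fin (d + 1)) ∧ p.2 ∈ stdSimplex ℝ (Fin (d' + 1)) ∧
          π p.1 = π' p.2},
      (∀ i, ∃ z : ℤ, x.1 i = (z : ℝ)) ∧ (∀ j, ∃ z : ℤ, x.2 j = (z : ℝ)) := by
  intro x hx
  choose f hf using hπ
  choose g hg using hπ'
  rw [fiberProduct_stdSimplex_eq_convexHull π π' f g hf hg] at hx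
  obtain ⟨i, j, -, rfl⟩ := extremePoints_convexHull_subset hx
  have hint : ∀ {n : ℕ} (k l : Fin n), ∃ z : ℤ, (Pi.single k 1 : Fin n → ℝ) l = (z : ℝ) :=
    fun k l => ⟨if l = k then 1 else 0, by simp [Pi.single_apply]⟩
  exact ⟨hint i, hint j⟩
end

section
/- Let M be a matrix whose rows belong to the root system B_n = {±e_i : 1 ≤ i ≤ n} ∪ {±e_i ± e_j : 1 ≤ i < j ≤ n}, let N be a matrix with k rows, each a standard unit vector e_i, and let w ∈ ℤ^k. If the linear system Mx = 0, Nx = w has a unique solution x ∈ ℝ^n, then this solution is integral, i.e. x ∈ ℤ^n. -/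
/-- `v` is a root of the root system `B_n ⊆ ℝ^n`: a short root `±eᵢ` or a long root
`±eᵢ ± eⱼ` (`i ≠ j`). -/
def IsBRoot {n : ℕ} (v : Fin n → ℝ) : Prop :=
  (∃ i : Fin n, v = Pi.single i 1 ∨ v = -Pi.single i 1) ∨
  (∃ i j : Fin n, i ≠ j ∧ ∃ ε δ : ℝ, (ε = 1 ∨ ε = -1) ∧ (δ = 1 ∨ δ = -1) ∧
    v = ε • (Pi.single i 1 : Fin n → ℝ) + δ • (Pi.single j 1 : Fin n → ℝ))

open Classical in
/-- The map fixing every integer and sending every other real number to `0`. -/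
noncomputable def integerPart (t : ℝ) : ℝ := if ∃ z : ℤ, t = z then t else 0

theorem exists_int_eq_integerPart (t : ℝ) : ∃ z : ℤ, integerPart t = z := by
  unfold integerPart
  split_ifs with h
  · exact h
  · exact ⟨0, by simp⟩

theorem integerPart_intCast (z : ℤ) : integerPart z = z := by
  simp [integerPart]

theorem integerPart_neg (t : ℝ) : integerPart (-t) = -integerPart t := by
  have h : (∃ z : ℤ, -t = z) ↔ ∃ z : ℤ, t = z :=
    ⟨fun ⟨z, hz⟩ => ⟨-z, by push_cast; linarith⟩, fun ⟨z, hz⟩ => ⟨-z, by push_cast; linarith⟩⟩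
  by_cases ht : ∃ z : ℤ, t = z
  · rw [integerPart, integerPart, if_pos ht, if_pos (h.2 ht)]
  · rw [integerPart, integerPart, if_neg ht, if_neg (mt h.1 ht), neg_zero]

/-- An odd function preserves the hyperplanes orthogonal to the roots of `B_n`. -/
theorem IsBRoot.sum_mul_odd_eq_zero {n : ℕ} {v x : Fin n → ℝ} (hv : IsBRoot v) {f : ℝ → ℝ}
    (hf : ∀ t, f (-t) = -f t) (hx : ∑ i, v i * x i = 0) : ∑ i, v i * f (x i) = 0 := by
  have hf0 : f 0 = 0 := by
    have h := hf 0
    rw [neg_zero] at h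
    linarith
  change v ⬝ᵥ x = 0 at hx
  change v ⬝ᵥ (fun i => f (x i)) = 0
  rcases hv with ⟨i, rfl | rfl⟩ | ⟨i, j, -, ε, δ, hε, hδ, rfl⟩
  · simp_all
  · simp_all
  · simp only [add_dotProduct, smul_dotProduct, single_one_dotProduct, smul_eq_mul] at hx ⊢
    rcases hε with rfl | rfl <;> rcases hδ with rfl | rfl
    · rw [show x i = -x j by linarith, hf]; ring
    · rw [show x i = x j by linarith]; ring
    · rw [show x i = x j by linarith]; ring
    · rw [show x i = -x j by linarith, hf]; ring

/-- **Integrality of unique solutions of `B_n`-systems.** Let `M` be a matrix whose rows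
lie in the root system `B_n`, let `N` be a matrix whose rows are standard unit vectors,
and let `w ∈ ℤ^k`.  If the system `M x = 0`, `N x = w` has a unique solution, then this
solution is integral. -/
theorem Bn_system_unique_solution_integral {n m k : ℕ}
    (M : Fin m → (Fin n → ℝ)) (hM : ∀ r, IsBRoot (M r))
    (N : Fin k → (Fin n → ℝ)) (hN : ∀ r, ∃ i : Fin n, N r = Pi.single i 1)
    (w : Fin k → ℤ) (x : Fin n → ℝ)
    (hxM : ∀ r, ∑ i, M r i * x i = 0)
    (hxN : ∀ r, ∑ i, N r i * x i = (w r : ℝ))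
    (huniq : ∀ y : Fin n → ℝ,
      (∀ r, ∑ i, M r i * y i = 0) → (∀ r, ∑ i, N r i * y i = (w r : ℝ)) → y = x) :
    ∀ i, ∃ z : ℤ, x i = (z : ℝ) := by
  have h : (fun i => integerPart (x i)) = x := by
    refine huniq _ (fun r => (hM r).sum_mul_odd_eq_zero integerPart_neg (hxM r)) fun r => ?_
    obtain ⟨i, hi⟩ := hN r
    have hw := hxN r
    change N r ⬝ᵥ x = _ at hw
    change N r ⬝ᵥ (fun i => integerPart (x i)) = _
    rw [hi, single_one_dotProduct] at hw ⊢
    rw [hw, integerPart_intCast]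
  intro i
  rw [← congrFun h i]
  exact exists_int_eq_integerPart (x i)
end
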